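/- arXiv:math/9910098 — 6 statements merged into one kernel-verified Lean document; each statement's English description precedes it below -/
import Mathlib

section
/- Let n ≥ 1, let V : ℝⁿ → ℝ be continuously differentiable with |V(z)| + |z·∇V(z)| ≤ C|z|^{−γ} for all |z| ≥ 1, where C > 0 and γ > 0, and let E > 0. Then there exists R ≥ 1 such that for every solution (z(t), ζ(t)) of the Hamiltonian system z′(t) = 2ζ(t), ζ′(t) = −∇V(z(t)) on an interval I, and every t ∈ I with |z(t)| ≥ R and |ζ(t)|² + V(z(t)) ∈ [E/2, 2E], one has (d/dt)(z(t)·ζ(t)) = 2|ζ(t)|² − z(t)·∇V(z(t)) ≥ E/2. -/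
/-- The convexity estimate near infinity: if `V` is `C¹` with
`|V(z)| + |z·∇V(z)| ≤ C|z|^{−γ}` for `|z| ≥ 1` and `E > 0`, then there is `R ≥ 1` such
that along any solution of `z′ = 2ζ`, `ζ′ = −∇V(z)` on an interval `I`, at any time
`t ∈ I` with `|z(t)| ≥ R` and energy `|ζ(t)|² + V(z(t)) ∈ [E/2, 2E]`, one has
`(d/dt)(z·ζ) = 2|ζ|² − z·∇V(z) ≥ E/2`. -/
theorem convexity_estimate (n : ℕ) (hn : 1 ≤ n)
    (V : EuclideanSpace ℝ (Fin n) → ℝ)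
    (gradV : EuclideanSpace ℝ (Fin n) → EuclideanSpace ℝ (Fin n))
    (hgrad : ∀ z, HasGradientAt V (gradV z) z) (hgradcont : Continuous gradV)
    (C γ E : ℝ) (hC : 0 < C) (hγ : 0 < γ) (hE : 0 < E)
    (hbound : ∀ z : EuclideanSpace ℝ (Fin n), 1 ≤ ‖z‖ →
      |V z| + |(inner ℝ z (gradV z) : ℝ)| ≤ C * ‖z‖ ^ (-γ)) :
    ∃ R : ℝ, 1 ≤ R ∧
      ∀ (I : Set ℝ) (z ζ : ℝ → EuclideanSpace ℝ (Fin n)),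
        (∀ s ∈ I, HasDerivAt z ((2 : ℝ) • ζ s) s) →
        (∀ s ∈ I, HasDerivAt ζ (-(gradV (z s))) s) →
        ∀ t ∈ I, R ≤ ‖z t‖ → (‖ζ t‖ ^ 2 + V (z t)) ∈ Set.Icc (E / 2) (2 * E) →
          HasDerivAt (fun s => (inner ℝ (z s) (ζ s) : ℝ))
            (2 * ‖ζ t‖ ^ 2 - (inner ℝ (z t) (gradV (z t)) : ℝ)) t ∧
          E / 2 ≤ 2 * ‖ζ t‖ ^ 2 - (inner ℝ (z t) (gradV (z t)) : ℝ) := by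
  have h1 : Filter.Tendsto (fun r : ℝ => C * r ^ (-γ)) Filter.atTop (nhds (C * 0)) :=
    (tendsto_rpow_neg_atTop hγ).const_mul C
  have h2 : ∀ᶠ r : ℝ in Filter.atTop, C * r ^ (-γ) < E / 4 :=
    h1.eventually_lt_const (by simpa using hE)
  obtain ⟨R, hR⟩ := Filter.eventually_atTop.1 h2
  refine ⟨max R 1, le_max_right _ _, ?_⟩
  intro I z ζ hz hζ t ht hRt hen
  constructor
  · have h := (hz t ht).inner ℝ (hζ t ht)
    have e : (2 * ‖ζ t‖ ^ 2 - (inner ℝ (z t) (gradV (z t)) : ℝ)) =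
        inner ℝ (z t) (-gradV (z t)) + inner ℝ ((2 : ℝ) • ζ t) (ζ t) := by
      rw [inner_neg_right, real_inner_smul_left, real_inner_self_eq_norm_sq]
      ring
    rw [e]
    exact h
  · have hb := hbound (z t) ((le_max_right _ _).trans hRt)
    have hr := hR ‖z t‖ ((le_max_left _ _).trans hRt)
    have := hen.1
    have a1 := le_abs_self (V (z t))
    have a2 := le_abs_self (inner ℝ (z t) (gradV (z t)) : ℝ)
    have a3 := abs_nonneg (inner ℝ (z t) (gradV (z t)) : ℝ)
    linarith
end

section
/- Let n ≥ 1, let V : ℝⁿ → ℝ be smooth with |V(z)| + |z·∇V(z)| ≤ C|z|^{−γ} for all |z| ≥ 1 (C > 0, γ > 0) and with ∇V bounded and globally Lipschitz, and let E > 0. Then there exists R ≥ 1 with the following property: for every T₀ ∈ ℝ and every global solution (z(t), ζ(t)) of z′(t) = 2ζ(t), ζ′(t) = −∇V(z(t)) whose energy |ζ|² + V(z) lies in [E/2, 2E] and which satisfies |z(t)| ≥ R for all t ≤ T₀, one has z(t)·ζ(t) → −∞ as t → −∞, and consequently |z(t)| → ∞ as t → −∞. -/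
open Filter

/-- If a global solution of `z′ = 2ζ`, `ζ′ = −∇V(z)` with energy in `[E/2, 2E]` stays in
the region `|z| ≥ R` for all `t ≤ T₀` (with `R` large, depending only on `V` and `E`),
then `z·ζ → −∞` and `|z| → ∞` as `t → −∞`. -/
theorem backward_escape (n : ℕ) (hn : 1 ≤ n)
    (V : EuclideanSpace ℝ (Fin n) → ℝ)
    (gradV : EuclideanSpace ℝ (Fin n) → EuclideanSpace ℝ (Fin n))
    (hVsmooth : ContDiff ℝ (⊤ : ℕ∞) V)
    (hgrad : ∀ z, HasGradientAt V (gradV z) z)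
    (C γ : ℝ) (hC : 0 < C) (hγ : 0 < γ)
    (hbound : ∀ z : EuclideanSpace ℝ (Fin n), 1 ≤ ‖z‖ →
      |V z| + |(inner ℝ z (gradV z) : ℝ)| ≤ C * ‖z‖ ^ (-γ))
    (M : ℝ) (hgradbd : ∀ z, ‖gradV z‖ ≤ M)
    (L : NNReal) (hgradlip : LipschitzWith L gradV)
    (E : ℝ) (hE : 0 < E) :
    ∃ R : ℝ, 1 ≤ R ∧
      ∀ (T₀ : ℝ) (z ζ : ℝ → EuclideanSpace ℝ (Fin n)),
        (∀ t : ℝ, HasDerivAt z ((2 : ℝ) • ζ t) t) →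
        (∀ t : ℝ, HasDerivAt ζ (-(gradV (z t))) t) →
        (∀ t : ℝ, (‖ζ t‖ ^ 2 + V (z t)) ∈ Set.Icc (E / 2) (2 * E)) →
        (∀ t : ℝ, t ≤ T₀ → R ≤ ‖z t‖) →
        Tendsto (fun t => (inner ℝ (z t) (ζ t) : ℝ)) atBot atBot ∧
        Tendsto (fun t => ‖z t‖) atBot atTop := by
  have hlim : Tendsto (fun r : ℝ => C * r ^ (-γ)) atTop (nhds (C * 0)) :=
    (tendsto_rpow_neg_atTop hγ).const_mul C
  rw [mul_zero] at hlim
  have hev : ∀ᶠ r : ℝ in atTop, C * r ^ (-γ) < E / 4 :=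
    hlim.eventually (gt_mem_nhds (by linarith))
  obtain ⟨R₀, hR₀⟩ := eventually_atTop.1 hev
  refine ⟨max R₀ 1, le_max_right _ _, ?_⟩
  intro T₀ z ζ hz hζ hen hR
  have hb : ∀ t, t ≤ T₀ → |V (z t)| + |(inner ℝ (z t) (gradV (z t)) : ℝ)| < E / 4 := by
    intro t ht
    have h := hR t ht
    exact (hbound (z t) ((le_max_right _ _).trans h)).trans_lt
      (hR₀ _ ((le_max_left _ _).trans h))
  have hd : ∀ t, HasDerivAt (fun t => (inner ℝ (z t) (ζ t) : ℝ) - E / 2 * t)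
      (2 * ‖ζ t‖ ^ 2 - inner ℝ (z t) (gradV (z t)) - E / 2) t := by
    intro t
    have h1 := ((hz t).inner ℝ (hζ t)).sub ((hasDerivAt_id t).const_mul (E / 2))
    refine h1.congr_deriv ?_
    rw [inner_neg_right, real_inner_smul_left, real_inner_self_eq_norm_sq]
    ring
  have hmono : MonotoneOn (fun t => (inner ℝ (z t) (ζ t) : ℝ) - E / 2 * t) (Set.Iic T₀) := by
    refine monotoneOn_of_deriv_nonneg (convex_Iic T₀)
      (fun t _ => (hd t).continuousAt.continuousWithinAt)
      (fun t _ => (hd t).differentiableAt.differentiableWithinAt) ?_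
    intro t ht
    rw [(hd t).deriv]
    have h := hb t (Set.mem_Iic.1 (interior_subset ht))
    have h1 := (hen t).1
    have h2 := le_abs_self (V (z t))
    have h3 := le_abs_self (inner ℝ (z t) (gradV (z t)) : ℝ)
    have h4 := abs_nonneg (V (z t))
    have h5 := abs_nonneg (inner ℝ (z t) (gradV (z t)) : ℝ)
    linarith
  have hf : Tendsto (fun t => (inner ℝ (z t) (ζ t) : ℝ)) atBot atBot := by
    have hlin : Tendsto (fun t : ℝ => E / 2 * t + ((inner ℝ (z T₀) (ζ T₀) : ℝ) - E / 2 * T₀))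
        atBot atBot :=
      tendsto_atBot_add_const_right _ _ (tendsto_id.const_mul_atBot (by linarith))
    refine tendsto_atBot_mono' _ ?_ hlin
    filter_upwards [eventually_le_atBot T₀] with t ht
    have h := hmono (Set.mem_Iic.2 ht) (Set.mem_Iic.2 le_rfl) ht
    simp only at h
    linarith
  refine ⟨hf, ?_⟩
  have hK : 0 < 1 + 3 * E := by linarith
  have hg : Tendsto (fun t => (1 + 3 * E)⁻¹ * (-(inner ℝ (z t) (ζ t) : ℝ))) atBot atTop :=
    (tendsto_neg_atBot_atTop.comp hf).const_mul_atTop (inv_pos.2 hK)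
  refine tendsto_atTop_mono' _ ?_ hg
  filter_upwards [eventually_le_atBot T₀] with t ht
  rw [inv_mul_le_iff₀ hK]
  have h1 := (neg_le_abs _).trans (abs_real_inner_le_norm (z t) (ζ t))
  have h2 : ‖ζ t‖ ≤ 1 + 3 * E := by
    have h := hb t ht
    have h3 := (hen t).2
    have h4 := neg_abs_le (V (z t))
    have h5 := abs_nonneg (inner ℝ (z t) (gradV (z t)) : ℝ)
    nlinarith [sq_nonneg (‖ζ t‖ - 1), sq_nonneg ‖ζ t‖]
  nlinarith [norm_nonneg (z t), mul_le_mul_of_nonneg_left h2 (norm_nonneg (z t))]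
end

section
/- Let n ≥ 1, let V : ℝⁿ → ℝ be a smooth long-range potential, and let λ > 0. Then there exists δ₁ > 0 with the following property: for every global Hamiltonian trajectory (z(t), ζ(t)) whose energy lies in (λ² − δ₁, λ² + δ₁) and which satisfies |z(t)| → ∞ as t → −∞, and for every R₀ > 0, there exists T > 0 such that for all t ≤ −T one has |z(t)| > R₀ and −z(t)·ζ(t)/|z(t)| > 2λ/3. -/
open Filter

/-- `V` is a smooth long-range potential: it is smooth and for some `γ > 0` all of its
iterated derivatives satisfy `‖D^k V(z)‖ ≤ C_k (1+|z|)^{−γ−k}`. -/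
def IsLongRangePotential {n : ℕ} (V : EuclideanSpace ℝ (Fin n) → ℝ) : Prop :=
  ContDiff ℝ (⊤ : ℕ∞) V ∧ ∃ γ : ℝ, 0 < γ ∧ ∀ k : ℕ, ∃ C : ℝ, 0 < C ∧
    ∀ z : EuclideanSpace ℝ (Fin n),
      ‖iteratedFDeriv ℝ k V z‖ ≤ C * (1 + ‖z‖) ^ (-γ - (k : ℝ))

/-- For a smooth long-range potential and `λ > 0` there is `δ₁ > 0` such that every
global Hamiltonian trajectory with energy in `(λ² − δ₁, λ² + δ₁)` which escapes to
infinity backward in time eventually satisfies `|z(t)| > R₀` and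
`−z(t)·ζ(t)/|z(t)| > 2λ/3` for all sufficiently negative `t`. -/
theorem backward_incoming_region (n : ℕ) (hn : 1 ≤ n)
    (V : EuclideanSpace ℝ (Fin n) → ℝ) (hV : IsLongRangePotential V)
    (lam : ℝ) (hlam : 0 < lam) :
    ∃ δ₁ : ℝ, 0 < δ₁ ∧
      ∀ z ζ : ℝ → EuclideanSpace ℝ (Fin n),
        (∀ t : ℝ, HasDerivAt z ((2 : ℝ) • ζ t) t) →
        (∀ t : ℝ, HasDerivAt ζ (-(gradient V (z t))) t) →
        (‖ζ 0‖ ^ 2 + V (z 0)) ∈ Set.Ioo (lam ^ 2 - δ₁) (lam ^ 2 + δ₁) →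
        Tendsto (fun t => ‖z t‖) atBot atTop →
        ∀ R₀ : ℝ, 0 < R₀ →
          ∃ T : ℝ, 0 < T ∧ ∀ t : ℝ, t ≤ -T →
            R₀ < ‖z t‖ ∧ 2 * lam / 3 < -(inner ℝ (z t) (ζ t) : ℝ) / ‖z t‖ := by
  obtain ⟨hsm, γ, hγ, hb⟩ := hV
  obtain ⟨C0, hC0, h0⟩ := hb 0
  obtain ⟨C1, hC1, h1⟩ := hb 1
  have hdiff : Differentiable ℝ V := hsm.differentiable (by simp)
  refine ⟨lam ^ 2 / 10, by positivity, ?_⟩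
  intro z ζ hz hζ hE hlim R₀ hR₀
  have hVd : ∀ t, HasDerivAt (fun t => V (z t)) (inner ℝ (gradient V (z t)) ((2 : ℝ) • ζ t)) t := by
    intro t
    have h := (hdiff (z t)).hasFDerivAt.comp_hasDerivAt t (hz t)
    have e : inner ℝ (gradient V (z t)) ((2 : ℝ) • ζ t) = fderiv ℝ V (z t) ((2 : ℝ) • ζ t) := by
      rw [gradient, InnerProductSpace.toDual_symm_apply]
    rw [e]; exact h
  have hcons : ∀ t, ‖ζ t‖ ^ 2 + V (z t) = ‖ζ 0‖ ^ 2 + V (z 0) := by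
    intro t
    have hd : ∀ s, HasDerivAt (fun s => ‖ζ s‖ ^ 2 + V (z s)) 0 s := by
      intro s
      have h := ((hζ s).norm_sq).add (hVd s)
      have e : 2 * inner ℝ (ζ s) (-gradient V (z s)) +
          inner ℝ (gradient V (z s)) ((2 : ℝ) • ζ s) = 0 := by
        rw [inner_neg_right, inner_smul_right, real_inner_comm]; ring
      rw [e] at h
      exact h
    exact is_const_of_deriv_eq_zero (fun s => (hd s).differentiableAt) (fun s => (hd s).deriv) t 0
  have hV0 : ∀ x, |V x| ≤ C0 * (1 + ‖x‖) ^ (-γ) := by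
    intro x
    have h := h0 x
    rw [norm_iteratedFDeriv_zero] at h
    simpa using h
  have hV1 : ∀ x, ‖x‖ * ‖gradient V x‖ ≤ C1 * (1 + ‖x‖) ^ (-γ) := by
    intro x
    have h := h1 x
    rw [norm_iteratedFDeriv_one] at h
    have e : ‖gradient V x‖ = ‖fderiv ℝ V x‖ := by
      rw [gradient, LinearIsometryEquiv.norm_map]
    rw [e]
    have hp : 0 < 1 + ‖x‖ := by positivity
    rw [Real.rpow_sub hp] at h
    simp only [Nat.cast_one, Real.rpow_one] at h
    calc ‖x‖ * ‖fderiv ℝ V x‖ ≤ (1 + ‖x‖) * (C1 * ((1 + ‖x‖) ^ (-γ) / (1 + ‖x‖))) := by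
          apply mul_le_mul (by linarith) h (norm_nonneg _) hp.le
      _ = _ := by field_simp
  have hdec : Tendsto (fun t => (1 + ‖z t‖) ^ (-γ)) atBot (nhds 0) :=
    (tendsto_rpow_neg_atTop hγ).comp (tendsto_atTop_add_const_left _ 1 hlim)
  have hl2 : 0 < lam ^ 2 := by positivity
  have ev0 : ∀ᶠ t in atBot, C0 * (1 + ‖z t‖) ^ (-γ) < lam ^ 2 / 100 := by
    have h := hdec.const_mul C0
    rw [mul_zero] at h
    exact h.eventually_lt_const (by positivity)
  have ev1 : ∀ᶠ t in atBot, C1 * (1 + ‖z t‖) ^ (-γ) < lam ^ 2 / 100 := by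
    have h := hdec.const_mul C1
    rw [mul_zero] at h
    exact h.eventually_lt_const (by positivity)
  obtain ⟨t0, ht0⟩ := eventually_atBot.1 (ev0.and (ev1.and (hlim.eventually_gt_atTop R₀)))
  have hζb : ∀ t ≤ t0, 0.89 * lam ^ 2 ≤ ‖ζ t‖ ^ 2 ∧ ‖ζ t‖ ≤ 1.1 * lam := by
    intro t ht
    have ha := (ht0 t ht).1
    have hv := abs_le.1 (hV0 (z t))
    have hc := hcons t
    refine ⟨by linarith [hE.1, hE.2], ?_⟩
    apply le_of_sq_le_sq _ (by positivity)
    nlinarith [hE.1, hE.2]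
  have hBd : ∀ t, HasDerivAt (fun t => inner ℝ (z t) (ζ t))
      (inner ℝ (z t) (-(gradient V (z t))) + inner ℝ ((2 : ℝ) • ζ t) (ζ t)) t :=
    fun t => (hz t).inner ℝ (hζ t)
  have hB : ∀ t ≤ t0, 1.7 * lam ^ 2 * (t0 - t) ≤ inner ℝ (z t0) (ζ t0) - inner ℝ (z t) (ζ t) := by
    intro t ht
    refine (convex_Iic t0).mul_sub_le_image_sub_of_le_deriv
      (f := fun t => inner ℝ (z t) (ζ t))
      (fun s _ => (hBd s).continuousAt.continuousWithinAt)
      (fun s _ => (hBd s).differentiableAt.differentiableWithinAt) ?_ t ht t0 Set.self_mem_Iic ht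
    intro s hs
    have hs : s ≤ t0 := Set.mem_Iic.1 (interior_subset hs)
    rw [(hBd s).deriv, inner_neg_right, inner_smul_left, real_inner_self_eq_norm_sq]
    have ha := (ht0 s hs).2.1
    have hg := hV1 (z s)
    have hi := real_inner_le_norm (z s) (gradient V (z s))
    have := (hζb s hs).1
    simp only [conj_trivial]
    linarith
  have hZ : ∀ t ≤ t0, ‖z t‖ ≤ ‖z t0‖ + 2.2 * lam * (t0 - t) := by
    intro t ht
    have h := (convex_Iic t0).norm_image_sub_le_of_norm_hasDerivWithin_le (f := z)
      (f' := fun s => (2 : ℝ) • ζ s) (C := 2.2 * lam)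
      (fun s _ => (hz s).hasDerivWithinAt) (by
        intro s hs
        rw [norm_smul]
        have := (hζb s hs).2
        norm_num at this ⊢
        linarith) (x := t0) (y := t) Set.self_mem_Iic ht
    have e : ‖t - t0‖ = t0 - t := by
      rw [Real.norm_eq_abs, abs_sub_comm, abs_of_nonneg (by linarith)]
    rw [e] at h
    have := norm_le_norm_add_norm_sub' (z t) (z t0)
    linarith
  set K : ℝ := 2 * lam / 3 * ‖z t0‖ + inner ℝ (z t0) (ζ t0) with hK
  refine ⟨max 1 (max (-t0) (-t0 + (|K| + 1) / (lam ^ 2 / 5))), by positivity, ?_⟩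
  intro t ht
  obtain ⟨-, m1, m2⟩ : 1 ≤ -t ∧ -t0 ≤ -t ∧ -t0 + (|K| + 1) / (lam ^ 2 / 5) ≤ -t := by
    have h := le_neg.1 ht
    rwa [max_le_iff, max_le_iff] at h
  have ht' : t ≤ t0 := by linarith
  have hR := (ht0 t ht').2.2
  refine ⟨hR, ?_⟩
  have hzp : 0 < ‖z t‖ := by linarith
  rw [lt_div_iff₀ hzp]
  have m3 : (|K| + 1) / (lam ^ 2 / 5) ≤ t0 - t := by linarith
  rw [div_le_iff₀ (by positivity)] at m3
  have hb' := hB t ht'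
  have hz' := mul_le_mul_of_nonneg_left (hZ t ht') (show 0 ≤ 2 * lam / 3 by positivity)
  have hKa := le_abs_self K
  have hq : 0 ≤ lam ^ 2 * (t0 - t) := mul_nonneg hl2.le (by linarith)
  have e : 2 * lam / 3 * (‖z t0‖ + 2.2 * lam * (t0 - t)) =
    2 * lam / 3 * ‖z t0‖ + 4.4 / 3 * (lam ^ 2 * (t0 - t)) := by ring
  rw [e] at hz'
  linarith
end

section
/- Let p : ℝ^{2n} → ℝ be smooth with Hamilton vector field H_p and Hamilton flow Φ_t, let ξ₀ ∈ ℝ^{2n} and T > 0, and assume Φ_{−t}(ξ₀) is defined for all t ∈ [−1, T+2] and that H_p does not vanish at any point of the trajectory segment Γ = {Φ_{−t}(ξ₀) : t ∈ [−1, T+2]}. Then for every open set U ⊇ Γ and every open set W containing the end segment {Φ_{−t}(ξ₀) : t ∈ [T+1/2, T+2]}, there exists a smooth compactly supported function q : ℝ^{2n} → ℝ such that q ≥ 0 everywhere, q(ξ₀) > 0, the support of q is contained in U, and (H_p q)(η) ≤ 0 for every η ∉ W. -/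
section EfHelpers
open Set Filter Topology

lemma ef_curve_smooth {E : Type*} [NormedAddCommGroup E] [NormedSpace ℝ E]
    (X : E → E) (hX : ContDiff ℝ (⊤ : ℕ∞) X) (γ : ℝ → E) (a b : ℝ)
    (hγ : ∀ t ∈ Ioo a b, HasDerivAt γ (-(X (γ t))) t) :
    ContDiffOn ℝ (⊤ : ℕ∞) γ (Ioo a b) := by
  rw [contDiffOn_infty]
  intro n
  induction n with
  | zero =>
    exact contDiffOn_zero.2 fun t ht => (hγ t ht).continuousAt.continuousWithinAt
  | succ n ih =>
    push_cast
    rw [contDiffOn_succ_iff_deriv_of_isOpen isOpen_Ioo]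
    refine ⟨fun t ht => (hγ t ht).differentiableAt.differentiableWithinAt, by simp, ?_⟩
    have h : ContDiffOn ℝ n (fun t => -(X (γ t))) (Ioo a b) :=
      ((hX.of_le (by exact_mod_cast le_top)).comp_contDiffOn ih).neg
    exact h.congr fun t ht => (hγ t ht).deriv

lemma ef_inv (φ : ℝ → ℝ) (t0 c : ℝ) (hφ : ∀ᶠ s in 𝓝 t0, ContDiffAt ℝ (⊤ : ℕ∞) φ s)
    (hc : c ≠ 0) (hd : HasDerivAt φ c t0) :
    ∃ g : ℝ → ℝ, (∀ᶠ u in 𝓝 (φ t0), ContDiffAt ℝ (⊤ : ℕ∞) g u) ∧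
      ∀ᶠ s in 𝓝 t0, g (φ s) = s := by
  have h0 : ContDiffAt ℝ (⊤ : ℕ∞) φ t0 := hφ.self_of_nhds
  have hne : ((⊤ : ℕ∞) : WithTop ℕ∞) ≠ 0 := by simp
  have hd' := hd.hasFDerivAt_equiv hc
  let e := h0.toOpenPartialHomeomorph φ hd' hne
  have hec : (e : ℝ → ℝ) = φ := h0.toOpenPartialHomeomorph_coe hd' hne
  have hs : t0 ∈ e.source := h0.mem_toOpenPartialHomeomorph_source hd' hne
  have ht : φ t0 ∈ e.target := h0.image_mem_toOpenPartialHomeomorph_target hd' hne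
  have hsymm : e.symm (φ t0) = t0 := by rw [← hec]; exact e.left_inv hs
  refine ⟨e.symm, ?_, ?_⟩
  · have hdc : ∀ᶠ s in 𝓝 t0, deriv φ s ≠ 0 := by
      have h1 : ContinuousAt (deriv φ) t0 :=
        (ContDiffAt.derivWithin (m := 0) h0 (by simp)).continuousAt
      exact h1.eventually_ne (by rw [hd.deriv]; exact hc)
    have hcont : Tendsto e.symm (𝓝 (φ t0)) (𝓝 t0) := by
      have := e.continuousAt_symm ht
      rw [ContinuousAt, hsymm] at this
      exact this
    filter_upwards [hcont.eventually hdc, hcont.eventually hφ, e.open_target.mem_nhds ht]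
      with u h1 h2 h3
    refine e.contDiffAt_symm_deriv h1 h3 ?_ ?_
    · rw [hec]
      exact (h2.differentiableAt hne).hasDerivAt
    · rw [hec]; exact h2
  · filter_upwards [e.open_source.mem_nhds hs] with s hs
    rw [← hec]; exact e.left_inv hs

lemma ef_coords {E : Type*} [NormedAddCommGroup E] [NormedSpace ℝ E]
    (B : E →L[ℝ] E →L[ℝ] ℝ) (hB : ∀ y, ‖y‖ ^ 2 ≤ B y y)
    (X : E → E) (hX : ContDiff ℝ (⊤ : ℕ∞) X) (γ : ℝ → E) (t0 : ℝ)
    (hγd : ∀ᶠ t in 𝓝 t0, HasDerivAt γ (-(X (γ t))) t)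
    (hγs : ∀ᶠ t in 𝓝 t0, ContDiffAt ℝ (⊤ : ℕ∞) γ t)
    (hnv : X (γ t0) ≠ 0) :
    ∃ τ θ : E → ℝ,
      (∀ᶠ x in 𝓝 (γ t0), ContDiffAt ℝ (⊤ : ℕ∞) τ x ∧ ContDiffAt ℝ (⊤ : ℕ∞) θ x ∧
        fderiv ℝ τ x (X x) < 0 ∧ 0 ≤ fderiv ℝ θ x (X x) ∧ 0 ≤ θ x ∧
        (θ x = 0 → x = γ (τ x))) ∧
      (∀ᶠ s in 𝓝 t0, τ (γ s) = s ∧ θ (γ s) = 0) := by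
  have hne : ((⊤ : ℕ∞) : WithTop ℕ∞) ≠ 0 := by simp
  have hγ0 := hγd.self_of_nhds
  obtain ⟨L, hL⟩ := SeparatingDual.exists_eq_one (R := ℝ) (neg_ne_zero.2 hnv)
  have hφd : HasDerivAt (fun s => L (γ s)) 1 t0 := by
    rw [← hL]
    exact L.hasFDerivAt.comp_hasDerivAt t0 hγ0
  obtain ⟨g, hg, hgl⟩ := ef_inv (fun s => L (γ s)) t0 1
    (hγs.mono fun s hs => L.contDiff.contDiffAt.comp s hs) one_ne_zero hφd
  have hγc : Tendsto γ (𝓝 t0) (𝓝 (γ t0)) := hγ0.continuousAt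
  set τ : E → ℝ := fun x => g (L x) with hτ
  have hτγ : ∀ᶠ s in 𝓝 t0, τ (γ s) = s := hgl
  have hτ0 : τ (γ t0) = t0 := hτγ.self_of_nhds
  have hτs : ∀ᶠ x in 𝓝 (γ t0), ContDiffAt ℝ (⊤ : ℕ∞) τ x := by
    have : Tendsto L (𝓝 (γ t0)) (𝓝 (L (γ t0))) := L.continuous.continuousAt
    filter_upwards [this.eventually hg] with x hx
    exact hx.comp x L.contDiff.contDiffAt
  have hτc : Tendsto τ (𝓝 (γ t0)) (𝓝 t0) := by
    have := hτs.self_of_nhds.continuousAt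
    rwa [ContinuousAt, hτ0] at this
  set y : E → E := fun x => x - γ (τ x) with hy
  have hys : ∀ᶠ x in 𝓝 (γ t0), ContDiffAt ℝ (⊤ : ℕ∞) y x := by
    filter_upwards [hτs, hτc.eventually hγs] with x h1 h2
    exact contDiffAt_id.sub (ContDiffAt.comp x h2 h1)
  have hyγ : ∀ᶠ s in 𝓝 t0, y (γ s) = 0 := by
    filter_upwards [hτγ] with s hs
    simp [hy, hs]
  -- transport along the curve
  have hFγ : ∀ᶠ s in 𝓝 t0, fderiv ℝ y (γ s) (X (γ s)) = 0 := by
    filter_upwards [hyγ.eventually_nhds, hγc.eventually hys, hγd] with s h1 h2 h3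
    have h4 := (h2.differentiableAt hne).hasFDerivAt.comp_hasDerivAt s h3
    have h5 : HasDerivAt (y ∘ γ) 0 s :=
      (hasDerivAt_const s (0 : E)).congr_of_eventuallyEq h1
    have := h4.unique h5
    simpa using this
  have hTγ : fderiv ℝ τ (γ t0) (X (γ t0)) = -1 := by
    have h4 := (hτs.self_of_nhds.differentiableAt hne).hasFDerivAt.comp_hasDerivAt t0 hγ0
    have h5 : HasDerivAt (τ ∘ γ) 1 t0 := (hasDerivAt_id t0).congr_of_eventuallyEq hτγ
    have := h4.unique h5
    rw [map_neg] at this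
    linarith
  have hTc : ContinuousAt (fun x => fderiv ℝ τ x (X x)) (γ t0) :=
    (hτs.self_of_nhds.continuousAt_fderiv hne).clm_apply hX.continuous.continuousAt
  have hT : ∀ᶠ x in 𝓝 (γ t0), fderiv ℝ τ x (X x) < -(1/2) := by
    apply hTc.eventually_lt_const
    change fderiv ℝ τ (γ t0) (X (γ t0)) < -(1/2)
    rw [hTγ]; norm_num
  have hF1 : ContDiffAt ℝ 1 (fun x => fderiv ℝ y x (X x)) (γ t0) :=
    (hys.self_of_nhds.fderiv_right (m := 1)
      (by rw [one_add_one_eq_two]; exact WithTop.coe_le_coe.2 (le_top : (2 : ℕ∞) ≤ ⊤))).clm_apply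
      (hX.contDiffAt.of_le (by exact_mod_cast le_top))
  obtain ⟨K, S, hS, hLip⟩ := hF1.exists_lipschitzOnWith
  have hF : ∀ᶠ x in 𝓝 (γ t0), ‖fderiv ℝ y x (X x)‖ ≤ K * ‖y x‖ := by
    have h1 := hγc.comp hτc
    filter_upwards [hS, h1.eventually hS, hτc.eventually hFγ] with x h2 h3 h4
    have := hLip.dist_le_mul x h2 (γ (τ x)) h3
    rwa [h4, dist_zero_right, dist_eq_norm] at this
  set a : ℝ := 4 * ‖B‖ * K with ha
  set θ : E → ℝ := fun x => Real.exp (-a * τ x) * B (y x) (y x) with hθ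
  refine ⟨τ, θ, ?_, ?_⟩
  · filter_upwards [hτs, hys, hT, hF] with x h1 h2 h3 h4
    have hpos : 0 ≤ B (y x) (y x) := le_trans (by positivity) (hB _)
    refine ⟨h1, ?_, by linarith, ?_, by positivity, ?_⟩
    · exact ((contDiffAt_const.mul h1).exp).mul
        ((B.contDiff.contDiffAt.comp x h2).clm_apply h2)
    · have d1 := (h1.differentiableAt hne).hasFDerivAt
      have d2 := (h2.differentiableAt hne).hasFDerivAt
      have d3 : HasFDerivAt θ _ x :=
        ((d1.const_mul (-a)).exp).mul ((B.hasFDerivAt.comp x d2).clm_apply d2)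
      rw [d3.fderiv]
      simp
      set v := fderiv ℝ y x (X x)
      set w := fderiv ℝ τ x (X x)
      have b1 : |B (y x) v| ≤ ‖B‖ * ‖y x‖ * ‖v‖ := B.le_opNorm₂ _ _
      have b2 : |B v (y x)| ≤ ‖B‖ * ‖v‖ * ‖y x‖ := B.le_opNorm₂ _ _
      have b3 : ‖B‖ * ‖y x‖ * ‖v‖ ≤ ‖B‖ * K * B (y x) (y x) := by
        calc ‖B‖ * ‖y x‖ * ‖v‖ ≤ ‖B‖ * ‖y x‖ * (K * ‖y x‖) := by gcongr
          _ = ‖B‖ * K * ‖y x‖ ^ 2 := by ring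
          _ ≤ _ := by gcongr; exact hB _
      have b4 : a * B (y x) (y x) * (1/2) ≤ a * B (y x) (y x) * (-w) := by
        gcongr; linarith
      have b5 := neg_abs_le (B (y x) v)
      have b6 := neg_abs_le (B v (y x))
      have key : 0 ≤ a * B (y x) (y x) * (-w) + B (y x) v + B v (y x) := by
        rw [ha] at b4 ⊢
        linarith
      have := mul_nonneg (Real.exp_pos (-(a * τ x))).le key
      linarith
    · intro h0
      have : B (y x) (y x) = 0 := by
        rcases mul_eq_zero.1 h0 with h | h
        · exact absurd h (Real.exp_pos _).ne'
        · exact h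
      have h5 : ‖y x‖ ^ 2 ≤ 0 := this ▸ hB (y x)
      have h6 : y x = 0 := by
        rw [← norm_eq_zero]; nlinarith [norm_nonneg (y x)]
      exact sub_eq_zero.1 h6
  · filter_upwards [hτγ, hyγ] with s h1 h2
    exact ⟨h1, by simp [hθ, h2]⟩

lemma ef_glue_deriv_pos (x : ℝ) (hx : 0 < x) : 0 < deriv expNegInvGlue x := by
  have h1 : expNegInvGlue =ᶠ[𝓝 x] fun u => Real.exp (-u⁻¹) := by
    filter_upwards [lt_mem_nhds hx] with u hu
    simp [expNegInvGlue, not_le.2 hu]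
  rw [h1.deriv_eq]
  have h2 : HasDerivAt (fun u : ℝ => Real.exp (-u⁻¹)) (Real.exp (-x⁻¹) * (-(-(x ^ 2)⁻¹))) x :=
    ((hasDerivAt_inv hx.ne').neg).exp
  rw [h2.deriv, neg_neg]
  positivity

lemma ef_cut (s0 a s1 s2 : ℝ) (h0 : s0 < a) (h1 : a < s1) (h2 : s1 < s2) :
    ∃ A : ℝ → ℝ, ContDiff ℝ (⊤ : ℕ∞) A ∧ (∀ t, 0 ≤ A t) ∧ (∀ t, t ∉ Icc s0 s2 → A t = 0) ∧
      (∀ t, t ∉ Icc s1 s2 → 0 ≤ deriv A t) ∧ 0 < deriv A a := by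
  have hpos : 0 < s2 - s1 := by linarith
  set A : ℝ → ℝ := fun t => expNegInvGlue (t - s0) * Real.smoothTransition ((s2 - t) / (s2 - s1))
    with hA
  have hlt : ∀ t, t < s1 → deriv A t = deriv expNegInvGlue (t - s0) := by
    intro t ht
    have : A =ᶠ[𝓝 t] fun u => expNegInvGlue (u - s0) := by
      filter_upwards [gt_mem_nhds ht] with u hu
      rw [hA]
      simp only
      rw [Real.smoothTransition.one_of_one_le, mul_one]
      rw [le_div_iff₀ hpos]; linarith
    rw [this.deriv_eq, deriv_comp_sub_const]
  refine ⟨A, ?_, ?_, ?_, ?_, ?_⟩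
  · exact (expNegInvGlue.contDiff.comp (contDiff_id.sub contDiff_const)).mul
      (Real.smoothTransition.contDiff.comp ((contDiff_const.sub contDiff_id).div_const _))
  · intro t
    exact mul_nonneg (expNegInvGlue.nonneg _) (Real.smoothTransition.nonneg _)
  · intro t ht
    rw [mem_Icc, not_and_or, not_le, not_le] at ht
    rcases ht with ht | ht
    · simp [hA, expNegInvGlue.zero_of_nonpos (show t - s0 ≤ 0 by linarith)]
    · simp only [hA]
      rw [Real.smoothTransition.zero_of_nonpos, mul_zero]
      exact div_nonpos_of_nonpos_of_nonneg (by linarith) hpos.le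
  · intro t ht
    rw [mem_Icc, not_and_or, not_le, not_le] at ht
    rcases ht with ht | ht
    · rw [hlt t ht]
      exact expNegInvGlue.monotone.deriv_nonneg
    · have : A =ᶠ[𝓝 t] fun u => 0 := by
        filter_upwards [lt_mem_nhds ht] with u hu
        simp only [hA]
        rw [Real.smoothTransition.zero_of_nonpos, mul_zero]
        exact div_nonpos_of_nonpos_of_nonneg (by linarith) hpos.le
      rw [this.deriv_eq]; simp
  · rw [hlt a h1]
    exact ef_glue_deriv_pos _ (by linarith)

/-- smooth, compactly supported in `U`, nonnegative -/
def EfGood {E : Type*} [NormedAddCommGroup E] [NormedSpace ℝ E] (U : Set E) (f : E → ℝ) : Prop :=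
  ContDiff ℝ (⊤ : ℕ∞) f ∧ HasCompactSupport f ∧ (∀ x, 0 ≤ f x) ∧ tsupport f ⊆ U

lemma ef_compact_sep {E : Type*} [TopologicalSpace E] (K O : Set E) (hK : IsCompact K)
    (hO : IsOpen O) (θ τ : E → ℝ) (hθ : ContinuousOn θ K) (hτ : ContinuousOn τ K)
    (u v : ℝ)
    (h : ∀ x ∈ K, τ x ∈ Icc u v → x ∉ O → 0 < θ x) :
    ∃ ρ > 0, ∀ x ∈ K, τ x ∈ Icc u v → θ x ≤ ρ → x ∈ O := by
  have hK2 : IsCompact ((K ∩ τ ⁻¹' Icc u v) ∩ Oᶜ) := by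
    have h1 : IsCompact (K ∩ Oᶜ) := hK.inter_right hO.isClosed_compl
    by_contra hcon
    exact hcon (by
      have h3 : IsCompact ((K ∩ Oᶜ) ∩ τ ⁻¹' Icc u v) := by
        obtain ⟨c, hc, hce⟩ := continuousOn_iff_isClosed.1
          (hτ.mono inter_subset_left : ContinuousOn τ (K ∩ Oᶜ)) (Icc u v) isClosed_Icc
        rw [inter_comm, hce, inter_comm]
        exact h1.inter_right hc
      convert h3 using 1
      ext x; simp only [mem_inter_iff]; tauto)
  rcases ((K ∩ τ ⁻¹' Icc u v) ∩ Oᶜ).eq_empty_or_nonempty with he | hne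
  · refine ⟨1, one_pos, fun x hx ht _ => ?_⟩
    by_contra hxO
    exact (he ▸ (⟨⟨hx, ht⟩, hxO⟩ : x ∈ (K ∩ τ ⁻¹' Icc u v) ∩ Oᶜ) : x ∈ (∅ : Set E))
  · obtain ⟨x0, hx0, hmin⟩ := hK2.exists_isMinOn hne
      (hθ.mono fun x hx => hx.1.1)
    have hp := h x0 hx0.1.1 hx0.1.2 hx0.2
    refine ⟨θ x0 / 2, by positivity, fun x hx ht hle => ?_⟩
    by_contra hxO
    have : θ x0 ≤ θ x := hmin (⟨⟨hx, ht⟩, hxO⟩ : x ∈ (K ∩ τ ⁻¹' Icc u v) ∩ Oᶜ)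
    linarith


lemma ef_step {E : Type*} [NormedAddCommGroup E] [NormedSpace ℝ E] [FiniteDimensional ℝ E]
    (X : E → E) (γ : ℝ → E) (t0 : ℝ)
    (hγc : ∀ᶠ t in 𝓝 t0, ContinuousAt γ t) (U : Set E) (hU : U ∈ 𝓝 (γ t0))
    (τ θ : E → ℝ)
    (hev : ∀ᶠ x in 𝓝 (γ t0), ContDiffAt ℝ (⊤ : ℕ∞) τ x ∧ ContDiffAt ℝ (⊤ : ℕ∞) θ x ∧
        fderiv ℝ τ x (X x) < 0 ∧ 0 ≤ fderiv ℝ θ x (X x) ∧ 0 ≤ θ x ∧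
        (θ x = 0 → x = γ (τ x)))
    (hevs : ∀ᶠ s in 𝓝 t0, τ (γ s) = s ∧ θ (γ s) = 0) :
    ∃ δ > 0, ∀ a b, a < b → a ∈ Metric.ball t0 δ → b ∈ Metric.ball t0 δ →
      ∀ N ∈ 𝓝 (γ b), ∃ f : E → ℝ, EfGood U f ∧ fderiv ℝ f (γ a) (X (γ a)) < 0 ∧
        ∀ x ∉ N, fderiv ℝ f x (X x) ≤ 0 := by
  have : ProperSpace E := FiniteDimensional.proper ℝ E
  have hne : ((⊤ : ℕ∞) : WithTop ℕ∞) ≠ 0 := by simp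
  obtain ⟨R, hR, hRK⟩ := Metric.nhds_basis_closedBall.mem_iff.1 (inter_mem hU hev)
  obtain ⟨δ, hδ, hδs⟩ := Metric.mem_nhds_iff.1 (inter_mem (inter_mem hevs hγc)
    (hγc.self_of_nhds.preimage_mem_nhds (Metric.ball_mem_nhds (γ t0) hR)))
  refine ⟨δ, hδ, fun a b hab ha hb N hN => ?_⟩
  obtain ⟨ε, hε, hεs⟩ := Metric.mem_nhds_iff.1 (inter_mem (Metric.isOpen_ball.mem_nhds hb)
    ((hδs hb).1.2.preimage_mem_nhds (interior_mem_nhds.2 hN)))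
  obtain ⟨ε', hε', hεs'⟩ := Metric.mem_nhds_iff.1 (Metric.isOpen_ball.mem_nhds ha)
  obtain ⟨s1, hs1a, hs1b⟩ := exists_between (max_lt hab (show b - ε < b by linarith))
  have hs1a' : a < s1 := (le_max_left _ _).trans_lt hs1a
  have hs1ε : b - ε < s1 := (le_max_right _ _).trans_lt hs1a
  set s2 := b + ε / 2 with hs2
  set s0 := a - ε' / 2 with hs0
  have hs02 : ∀ s ∈ Icc s0 s2, s ∈ Metric.ball t0 δ := by
    have h0 : s0 ∈ Metric.ball t0 δ := hεs' (by
      rw [Metric.mem_ball, Real.dist_eq, abs_lt]; constructor <;> linarith)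
    have h2 : s2 ∈ Metric.ball t0 δ := (hεs (by
      rw [Metric.mem_ball, Real.dist_eq, abs_lt]; constructor <;> linarith)).1
    rw [Real.ball_eq_Ioo] at *
    exact fun s hs => ⟨h0.1.trans_le hs.1, hs.2.trans_lt h2.2⟩
  have hs12 : ∀ s ∈ Icc s1 s2, γ s ∈ interior N := fun s hs => (hεs (by
      rw [Metric.mem_ball, Real.dist_eq, abs_lt]; constructor <;> linarith [hs.1, hs.2])).2
  obtain ⟨A, hAs, hA0, hAz, hAd, hAa⟩ := ef_cut s0 a s1 s2 (by linarith) hs1a' (by linarith)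
  set K := Metric.closedBall (γ t0) R with hK
  have hKc : IsCompact K := isCompact_closedBall _ _
  have hτK : ContinuousOn τ K := fun x hx => (hRK hx).2.1.continuousAt.continuousWithinAt
  have hθK : ContinuousOn θ K := fun x hx => (hRK hx).2.2.1.continuousAt.continuousWithinAt
  obtain ⟨ρ1, hρ1, hsep1⟩ := ef_compact_sep K (Metric.ball (γ t0) R) hKc Metric.isOpen_ball θ τ
    hθK hτK s0 s2 (by
      intro x hx ht hxO
      obtain ⟨-, -, -, -, -, h5, h6⟩ := hRK hx
      refine lt_of_le_of_ne h5 fun h => hxO ?_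
      rw [h6 h.symm]
      exact (hδs (hs02 _ ht)).2)
  obtain ⟨ρ2, hρ2, hsep2⟩ := ef_compact_sep K (interior N) hKc isOpen_interior θ τ
    hθK hτK s1 s2 (by
      intro x hx ht hxO
      obtain ⟨-, -, -, -, -, h5, h6⟩ := hRK hx
      refine lt_of_le_of_ne h5 fun h => hxO ?_
      rw [h6 h.symm]
      exact hs12 _ ht)
  set ρ := min ρ1 ρ2 with hρ
  have hρ0 : 0 < ρ := lt_min hρ1 hρ2
  set Bf : ℝ → ℝ := fun u => expNegInvGlue (ρ - u) with hBf
  have hBs : ContDiff ℝ (⊤ : ℕ∞) Bf :=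
    expNegInvGlue.contDiff.comp (contDiff_const.sub contDiff_id)
  have hBz : ∀ u, ρ ≤ u → Bf u = 0 := fun u hu =>
    expNegInvGlue.zero_of_nonpos (by linarith)
  have hBd : ∀ u, deriv Bf u ≤ 0 := fun u => by
    have : Antitone Bf := fun u v huv => expNegInvGlue.monotone (by linarith)
    exact this.deriv_nonpos
  have hB0 : ∀ u, 0 ≤ Bf u := fun u => expNegInvGlue.nonneg _
  set F : E → ℝ := fun x => A (τ x) * Bf (θ x) with hF
  classical
  set f : E → ℝ := fun x => if x ∈ Metric.ball (γ t0) R then F x else 0 with hf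
  set Z : Set E := K ∩ (fun x => (τ x, θ x)) ⁻¹' (Icc s0 s2 ×ˢ Iic ρ) with hZ
  have hZc : IsClosed Z := (hτK.prodMk hθK).preimage_isClosed_of_isClosed
    Metric.isClosed_closedBall (isClosed_Icc.prod isClosed_Iic)
  have hZK : Z ⊆ K := inter_subset_left
  have hZb : Z ⊆ Metric.ball (γ t0) R := fun x hx =>
    hsep1 x hx.1 hx.2.1 (le_trans hx.2.2 (min_le_left _ _))
  have hfZ : ∀ x, x ∉ Z → f x = 0 := by
    intro x hx
    by_cases hxb : x ∈ Metric.ball (γ t0) R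
    · simp only [hf, if_pos hxb, hF]
      by_contra hcon
      have h1 : A (τ x) ≠ 0 := left_ne_zero_of_mul hcon
      have h2 : Bf (θ x) ≠ 0 := right_ne_zero_of_mul hcon
      refine hx ⟨Metric.ball_subset_closedBall hxb, ?_, ?_⟩
      · by_contra h; exact h1 (hAz _ h)
      · by_contra h; exact h2 (hBz _ (not_le.1 h).le)
    · simp only [hf, if_neg hxb]
  have htsZ : tsupport f ⊆ Z := closure_minimal (fun x hx => by
    by_contra h; exact hx (hfZ x h)) hZc
  have hfF : ∀ x ∈ Metric.ball (γ t0) R, f =ᶠ[𝓝 x] F := by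
    intro x hx
    filter_upwards [Metric.isOpen_ball.mem_nhds hx] with z hz
    simp only [hf, if_pos hz]
  have hf0 : ∀ x ∉ Z, f =ᶠ[𝓝 x] fun _ => 0 := by
    intro x hx
    filter_upwards [hZc.isOpen_compl.mem_nhds hx] with z hz
    exact hfZ z hz
  have hder : ∀ x ∈ Metric.ball (γ t0) R, fderiv ℝ f x (X x) =
      A (τ x) * (deriv Bf (θ x) * fderiv ℝ θ x (X x)) +
        Bf (θ x) * (deriv A (τ x) * fderiv ℝ τ x (X x)) := by
    intro x hx
    obtain ⟨-, h1, h2, -⟩ := hRK (Metric.ball_subset_closedBall hx)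
    rw [(hfF x hx).fderiv_eq]
    have d1 := (hAs.differentiable hne (τ x)).hasDerivAt.comp_hasFDerivAt x
      (h1.differentiableAt hne).hasFDerivAt
    have d2 := (hBs.differentiable hne (θ x)).hasDerivAt.comp_hasFDerivAt x
      (h2.differentiableAt hne).hasFDerivAt
    have d3 : HasFDerivAt F _ x := d1.mul d2
    rw [d3.fderiv]
    simp
  refine ⟨f, ⟨?_, ?_, ?_, ?_⟩, ?_, ?_⟩
  · rw [contDiff_iff_contDiffAt]
    intro x
    by_cases hx : x ∈ Z
    · obtain ⟨-, h1, h2, -⟩ := hRK (hZK hx)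
      exact ((hAs.contDiffAt.comp x h1).mul (hBs.contDiffAt.comp x h2)).congr_of_eventuallyEq
        (hfF x (hZb hx))
    · exact contDiffAt_const.congr_of_eventuallyEq (hf0 x hx)
  · exact hKc.of_isClosed_subset (isClosed_tsupport f) (htsZ.trans hZK)
  · intro x
    by_cases hxb : x ∈ Metric.ball (γ t0) R
    · simp only [hf, if_pos hxb]; exact mul_nonneg (hA0 _) (hB0 _)
    · simp only [hf, if_neg hxb]; exact le_rfl
  · exact fun x hx => (hRK (hZK (htsZ hx))).1
  · have hab := (hδs ha).2
    obtain ⟨-, -, -, h3, h4, -⟩ := hRK (Metric.ball_subset_closedBall hab)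
    rw [hder _ hab]
    obtain ⟨e1, e2⟩ := (hδs ha).1.1
    have p1 : A (τ (γ a)) * (deriv Bf (θ (γ a)) * fderiv ℝ θ (γ a) (X (γ a))) ≤ 0 :=
      mul_nonpos_of_nonneg_of_nonpos (hA0 _) (mul_nonpos_of_nonpos_of_nonneg (hBd _) h4)
    have p2 : Bf (θ (γ a)) * (deriv A (τ (γ a)) * fderiv ℝ τ (γ a) (X (γ a))) < 0 := by
      rw [e1, e2]
      refine mul_neg_of_pos_of_neg (expNegInvGlue.pos_of_pos (by linarith))
        (mul_neg_of_pos_of_neg hAa h3)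
    linarith
  · intro x hxN
    by_cases hx : x ∈ Z
    · have hxb := hZb hx
      obtain ⟨-, -, -, h3, h4, -⟩ := hRK (hZK hx)
      rw [hder _ hxb]
      have p1 : A (τ x) * (deriv Bf (θ x) * fderiv ℝ θ x (X x)) ≤ 0 :=
        mul_nonpos_of_nonneg_of_nonpos (hA0 _) (mul_nonpos_of_nonpos_of_nonneg (hBd _) h4)
      have hτn : τ x ∉ Icc s1 s2 := fun h => hxN (interior_subset
        (hsep2 x hx.1 h (le_trans hx.2.2 (min_le_right _ _))))
      have p2 : Bf (θ x) * (deriv A (τ x) * fderiv ℝ τ x (X x)) ≤ 0 :=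
        mul_nonpos_of_nonneg_of_nonpos (hB0 _)
          (mul_nonpos_of_nonneg_of_nonpos (hAd _ hτn) h3.le)
      linarith
    · rw [(hf0 x hx).fderiv_eq]; simp

lemma ef_combine {E : Type*} [NormedAddCommGroup E] [NormedSpace ℝ E]
    (X : E → E) (hX : Continuous X) (U N : Set E) (xi xa : E)
    (hS : ∀ M ∈ 𝓝 xa, ∃ g : E → ℝ, EfGood U g ∧ 0 < g xi ∧ ∀ x ∉ M, fderiv ℝ g x (X x) ≤ 0)
    (f : E → ℝ) (hf : EfGood U f) (hfa : fderiv ℝ f xa (X xa) < 0)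
    (hfN : ∀ x ∉ N, fderiv ℝ f x (X x) ≤ 0) :
    ∃ q : E → ℝ, EfGood U q ∧ 0 < q xi ∧ ∀ x ∉ N, fderiv ℝ q x (X x) ≤ 0 := by
  have hne : ((⊤ : ℕ∞) : WithTop ℕ∞) ≠ 0 := by simp
  obtain ⟨hf1, hf2, hf3, hf4⟩ := hf
  have hfc : Continuous fun x => fderiv ℝ f x (X x) := (hf1.continuous_fderiv hne).clm_apply hX
  obtain ⟨e, he1, he2⟩ := exists_between hfa
  obtain ⟨g, ⟨hg1, hg2, hg3, hg4⟩, hgx, hgM⟩ := hS {x | fderiv ℝ f x (X x) < e}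
    ((isOpen_lt hfc continuous_const).mem_nhds he1)
  have hgc : Continuous fun x => fderiv ℝ g x (X x) := (hg1.continuous_fderiv hne).clm_apply hX
  have hgcs : HasCompactSupport fun x => fderiv ℝ g x (X x) := by
    refine (hg2.fderiv (𝕜 := ℝ)).mono fun x hx => ?_
    intro h
    apply hx
    simp [h]
  obtain ⟨C, hC⟩ := hgcs.exists_bound_of_continuous hgc
  have hC0 : 0 ≤ C := (norm_nonneg _).trans (hC xi)
  have hk : 0 ≤ C / (-e) := div_nonneg hC0 (by linarith)
  refine ⟨fun x => g x + (C / (-e)) * f x, ⟨?_, ?_, ?_, ?_⟩, ?_, ?_⟩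
  · exact hg1.add (contDiff_const.mul hf1)
  · exact hg2.add hf2.mul_left
  · exact fun x => add_nonneg (hg3 x) (mul_nonneg hk (hf3 x))
  · refine (tsupport_add _ _).trans (union_subset hg4 ?_)
    exact (tsupport_mul_subset_right).trans hf4
  · exact add_pos_of_pos_of_nonneg hgx (mul_nonneg hk (hf3 xi))
  · intro x hx
    have d : HasFDerivAt (fun x => g x + (C / (-e)) * f x) _ x :=
      (hg1.differentiable hne x).hasFDerivAt.add
        ((hf1.differentiable hne x).hasFDerivAt.const_mul (C / (-e)))
    rw [d.fderiv]
    simp only [add_apply, smul_apply, smul_eq_mul]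
    by_cases hxM : fderiv ℝ f x (X x) < e
    · have h1 := (le_abs_self _).trans (hC x)
      have h2 : C / (-e) * fderiv ℝ f x (X x) ≤ C / (-e) * e := by gcongr
      have h3 : C / (-e) * e = -C := by
        have he3 : e ≠ 0 := he2.ne
        field_simp
      linarith
    · have h1 := hgM x hxM
      have h2 := mul_nonpos_of_nonneg_of_nonpos hk (hfN x hx)
      linarith

lemma ef_main {E : Type*} [NormedAddCommGroup E] [NormedSpace ℝ E] [FiniteDimensional ℝ E]
    (B : E →L[ℝ] E →L[ℝ] ℝ) (hB : ∀ y, ‖y‖ ^ 2 ≤ B y y)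
    (X : E → E) (hX : ContDiff ℝ (⊤ : ℕ∞) X) (γ : ℝ → E) (a b c : ℝ) (ha : a < 0) (hb : 0 ≤ b)
    (hbc : b < c)
    (hγ : ∀ t ∈ Ioo a c, HasDerivAt γ (-(X (γ t))) t)
    (hnv : ∀ t ∈ Ioo a c, X (γ t) ≠ 0)
    (U : Set E) (hU : IsOpen U) (hΓU : ∀ t ∈ Ioo a c, γ t ∈ U)
    (W : Set E) (hW : W ∈ 𝓝 (γ b)) :
    ∃ q : E → ℝ, EfGood U q ∧ 0 < q (γ 0) ∧ ∀ x ∉ W, fderiv ℝ q x (X x) ≤ 0 := by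
  set S : ℝ → Prop := fun s => ∀ M ∈ 𝓝 (γ s), ∃ g : E → ℝ, EfGood U g ∧ 0 < g (γ 0) ∧
    ∀ x ∉ M, fderiv ℝ g x (X x) ≤ 0 with hS
  have hγs := ef_curve_smooth X hX γ a c hγ
  have hsub : ∀ t : Icc (0 : ℝ) b, (t : ℝ) ∈ Ioo a c := fun t =>
    ⟨ha.trans_le t.2.1, t.2.2.trans_lt hbc⟩
  have hloc : ∀ t : Icc (0 : ℝ) b, ∃ δ > 0, ∀ u v, u < v → u ∈ Metric.ball (t : ℝ) δ →
      v ∈ Metric.ball (t : ℝ) δ → S u → S v := by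
    intro t
    have hev : ∀ᶠ s in 𝓝 (t : ℝ), s ∈ Ioo a c := isOpen_Ioo.mem_nhds (hsub t)
    obtain ⟨τ, θ, h1, h2⟩ := ef_coords B hB X hX γ t (hev.mono hγ)
      (hev.mono fun s hs => hγs.contDiffAt (isOpen_Ioo.mem_nhds hs)) (hnv t (hsub t))
    obtain ⟨δ, hδ, h3⟩ := ef_step X γ t (hev.mono fun s hs => (hγ s hs).continuousAt) U
      (hU.mem_nhds (hΓU t (hsub t))) τ θ h1 h2
    refine ⟨δ, hδ, fun u v huv hu hv hSu N hN => ?_⟩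
    obtain ⟨f, hf1, hf2, hf3⟩ := h3 u v huv hu hv N hN
    exact ef_combine X hX.continuous U N (γ 0) (γ u) hSu f hf1 hf2 hf3
  have hS0 : S 0 := by
    intro M hM
    obtain ⟨f, f1, f2, f3, f4, f5⟩ := exists_contDiff_tsupport_subset (n := ⊤)
      (inter_mem hM (hU.mem_nhds (hΓU 0 ⟨ha, hb.trans_lt hbc⟩)))
    refine ⟨f, ⟨f3, f2, fun x => (f4 ⟨x, rfl⟩).1, fun x hx => (f1 hx).2⟩, by simp [f5], ?_⟩
    intro x hx
    have : x ∉ tsupport f := fun h => hx (f1 h).1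
    rw [fderiv_of_notMem_tsupport ℝ this]
    simp
  choose δ hδ hstep using hloc
  obtain ⟨t, ht0, htm, ⟨m, hm⟩, hti⟩ := exists_monotone_Icc_subset_open_cover_Icc hb
    (c := fun i : Icc (0 : ℝ) b => Metric.ball i (δ i)) (fun i => Metric.isOpen_ball)
    (fun x _ => mem_iUnion.2 ⟨x, Metric.mem_ball_self (hδ x)⟩)
  have hall : ∀ k, S (t k) := by
    intro k
    induction k with
    | zero => rw [ht0]; exact hS0
    | succ k ih =>
      have hle : t k ≤ t (k + 1) := htm (Nat.le_succ k)
      rcases hle.eq_or_lt with h | h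
      · rw [← h]; exact ih
      · obtain ⟨i, hi⟩ := hti k
        exact hstep i _ _ h (hi (left_mem_Icc.2 hle)) (hi (right_mem_Icc.2 hle)) ih
  have := hall m
  rw [hm m le_rfl] at this
  exact this W hW

end EfHelpers

/-- Construction of the escape function supported in a tube around a backward
bicharacteristic segment. Here `p : ℝⁿ_z × ℝⁿ_ζ → ℝ` is smooth, `X` is its Hamilton
vector field `X = (∇_ζ p, −∇_z p)` (so `H_p q (η) = dq(η)(X(η))`), and
`γ(t) = Φ_{−t}(ξ₀)` is the backward flow, defined and with nonvanishing `X` on the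
parameter interval `[−1, T+2]`. For any open `U` containing the trajectory segment and
any open `W` containing the end segment `{Φ_{−t}(ξ₀) : t ∈ [T+1/2, T+2]}`, there is a
smooth compactly supported `q ≥ 0` with `q(ξ₀) > 0`, `supp q ⊆ U`, and `H_p q ≤ 0`
outside `W`. -/
theorem escape_function_along_segment (n : ℕ) (hn : 1 ≤ n)
    (p : EuclideanSpace ℝ (Fin n) × EuclideanSpace ℝ (Fin n) → ℝ)
    (hp : ContDiff ℝ (⊤ : ℕ∞) p)
    (X : EuclideanSpace ℝ (Fin n) × EuclideanSpace ℝ (Fin n) →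
      EuclideanSpace ℝ (Fin n) × EuclideanSpace ℝ (Fin n))
    (hX : ∀ w : EuclideanSpace ℝ (Fin n) × EuclideanSpace ℝ (Fin n),
      X w = (gradient (fun ζ => p (w.1, ζ)) w.2,
             -(gradient (fun z => p (z, w.2)) w.1)))
    (ξ₀ : EuclideanSpace ℝ (Fin n) × EuclideanSpace ℝ (Fin n)) (T : ℝ) (hT : 0 < T)
    (γ : ℝ → EuclideanSpace ℝ (Fin n) × EuclideanSpace ℝ (Fin n)) (hγ0 : γ 0 = ξ₀)
    (hγ : ∀ t ∈ Set.Icc (-1 : ℝ) (T + 2), HasDerivAt γ (-(X (γ t))) t)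
    (hnv : ∀ t ∈ Set.Icc (-1 : ℝ) (T + 2), X (γ t) ≠ 0)
    (U : Set (EuclideanSpace ℝ (Fin n) × EuclideanSpace ℝ (Fin n)))
    (hU : IsOpen U) (hΓU : γ '' Set.Icc (-1 : ℝ) (T + 2) ⊆ U)
    (W : Set (EuclideanSpace ℝ (Fin n) × EuclideanSpace ℝ (Fin n)))
    (hW : IsOpen W) (hendW : γ '' Set.Icc (T + 1/2) (T + 2) ⊆ W) :
    ∃ q : EuclideanSpace ℝ (Fin n) × EuclideanSpace ℝ (Fin n) → ℝ,
      ContDiff ℝ (⊤ : ℕ∞) q ∧ HasCompactSupport q ∧ (∀ η, 0 ≤ q η) ∧ 0 < q ξ₀ ∧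
      tsupport q ⊆ U ∧ ∀ η ∉ W, fderiv ℝ q η (X η) ≤ 0 := by
  have hXs : ContDiff ℝ (⊤ : ℕ∞) X := by
    have hXe : X = fun w => (gradient (fun ζ => p (w.1, ζ)) w.2,
             -(gradient (fun z => p (z, w.2)) w.1)) := funext hX
    rw [hXe]
    unfold gradient
    have hle : ((⊤ : ℕ∞) : WithTop ℕ∞) + 1 ≤ ((⊤ : ℕ∞) : WithTop ℕ∞) := by simp
    refine ContDiff.prodMk ?_ (ContDiff.neg ?_)
    · refine (InnerProductSpace.toDual ℝ (EuclideanSpace ℝ (Fin n))).symm.contDiff.comp ?_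
      refine ContDiff.fderiv (n := (⊤ : ℕ∞))
        (f := fun (w : EuclideanSpace ℝ (Fin n) × EuclideanSpace ℝ (Fin n)) ζ => p (w.1, ζ))
        ?_ contDiff_snd hle
      exact hp.comp (contDiff_fst.fst.prodMk contDiff_snd)
    · refine (InnerProductSpace.toDual ℝ (EuclideanSpace ℝ (Fin n))).symm.contDiff.comp ?_
      refine ContDiff.fderiv (n := (⊤ : ℕ∞))
        (f := fun (w : EuclideanSpace ℝ (Fin n) × EuclideanSpace ℝ (Fin n)) z => p (z, w.2))
        ?_ contDiff_fst hle
      exact hp.comp (contDiff_snd.prodMk contDiff_fst.snd)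
  let i1 := ContinuousLinearMap.fst ℝ (EuclideanSpace ℝ (Fin n)) (EuclideanSpace ℝ (Fin n))
  let i2 := ContinuousLinearMap.snd ℝ (EuclideanSpace ℝ (Fin n)) (EuclideanSpace ℝ (Fin n))
  let B0 : EuclideanSpace ℝ (Fin n) →L[ℝ] EuclideanSpace ℝ (Fin n) →L[ℝ] ℝ := innerSL ℝ
  obtain ⟨q, ⟨q1, q2, q3, q4⟩, q5, q6⟩ := ef_main
    (B0.bilinearComp i1 i1 + B0.bilinearComp i2 i2)
    (by
      intro y
      have h : (B0.bilinearComp i1 i1 + B0.bilinearComp i2 i2) y y = ‖y.1‖ ^ 2 + ‖y.2‖ ^ 2 := by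
        rw [← real_inner_self_eq_norm_sq, ← real_inner_self_eq_norm_sq]
        rfl
      rw [h, Prod.norm_def]
      rcases max_choice ‖y.1‖ ‖y.2‖ with h | h <;> rw [h] <;>
        nlinarith [sq_nonneg ‖y.1‖, sq_nonneg ‖y.2‖])
    X hXs γ (-1) (T + 1) (T + 2) (by norm_num) (by linarith) (by linarith)
    (fun t ht => hγ t (Set.Ioo_subset_Icc_self ht))
    (fun t ht => hnv t (Set.Ioo_subset_Icc_self ht)) U hU
    (fun t ht => hΓU ⟨t, Set.Ioo_subset_Icc_self ht, rfl⟩) W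
    (hW.mem_nhds (hendW ⟨T + 1, ⟨by linarith, by linarith⟩, rfl⟩))
  exact ⟨q, q1, q2, q3, hγ0 ▸ q5, q4, q6⟩
end

section
/- Let n ≥ 1, let V : ℝⁿ → ℝ be a smooth long-range potential, and let λ₀ > 0 be such that every global Hamiltonian trajectory with energy λ₀ satisfies |z(t)| → ∞ as t → +∞ and as t → −∞. Then there exists δ₀ > 0 such that every global Hamiltonian trajectory with energy in (λ₀ − δ₀, λ₀ + δ₀) satisfies |z(t)| → ∞ as t → +∞ and as t → −∞. -/
open Filter

lemma aux_right {f : ℝ → ℝ} {d s : ℝ} (h : HasDerivAt f d s) (hd : 0 < d) :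
    ∀ᶠ t in nhdsWithin s (Set.Ioi s), f s < f t := by
  have h1 := (hasDerivAt_iff_tendsto_slope.1 h).mono_left
    (nhdsWithin_mono s (fun t (ht : s < t) => ne_of_gt ht) : nhdsWithin s (Set.Ioi s) ≤ _)
  filter_upwards [h1.eventually (lt_mem_nhds hd), self_mem_nhdsWithin] with t ht hst
  have hst : 0 < t - s := sub_pos.2 hst
  rw [slope_def_field, div_pos_iff] at ht
  rcases ht with ht | ht <;> linarith [ht.1, ht.2]

lemma aux_left {f : ℝ → ℝ} {d s : ℝ} (h : HasDerivAt f d s) (hd : d < 0) :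
    ∀ᶠ t in nhdsWithin s (Set.Iio s), f s < f t := by
  have h1 := (hasDerivAt_iff_tendsto_slope.1 h).mono_left
    (nhdsWithin_mono s (fun t (ht : t < s) => ne_of_lt ht) : nhdsWithin s (Set.Iio s) ≤ _)
  filter_upwards [h1.eventually (gt_mem_nhds hd), self_mem_nhdsWithin] with t ht hst
  have hst : t - s < 0 := sub_neg.2 hst
  rw [slope_def_field, div_neg_iff] at ht
  rcases ht with ht | ht <;> linarith [ht.1, ht.2]

lemma aux_grow {f f' : ℝ → ℝ} (hf : ∀ t, HasDerivAt f (f' t) t) {a b c : ℝ} (hab : a ≤ b)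
    (h : ∀ t, a ≤ t → t ≤ b → c ≤ f' t) : f a + c * (b - a) ≤ f b := by
  have := (convex_Icc a b).mul_sub_le_image_sub_of_le_deriv (f := f) (C := c)
    (fun t _ => (hf t).continuousAt.continuousWithinAt)
    (fun t _ => (hf t).differentiableAt.differentiableWithinAt)
    (fun t ht => by
      rw [interior_Icc] at ht
      rw [(hf t).deriv]; exact h t ht.1.le ht.2.le)
    a (Set.left_mem_Icc.2 hab) b (Set.right_mem_Icc.2 hab) hab
  linarith

lemma aux_second {g g' : ℝ → ℝ} {d s : ℝ} (hg : ∀ t, HasDerivAt g (g' t) t)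
    (hg' : HasDerivAt g' d s) (hd : 0 < d) (h0 : 0 ≤ g' s) {b : ℝ} (hb : s < b) :
    ∃ t, s < t ∧ t < b ∧ g s < g t := by
  have h1 := aux_right hg' hd
  obtain ⟨u, hu, h2⟩ := mem_nhdsGT_iff_exists_Ioo_subset.1 h1
  have hu : s < u := hu
  have hm : s < min u b := lt_min hu hb
  obtain ⟨t, ht1, ht2⟩ := exists_between hm
  refine ⟨t, ht1, lt_of_lt_of_le ht2 (min_le_right _ _), ?_⟩
  have : StrictMonoOn g (Set.Icc s t) := by
    apply strictMonoOn_of_deriv_pos (convex_Icc s t)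
    · exact fun t _ => (hg t).continuousAt.continuousWithinAt
    · intro r hr
      rw [interior_Icc] at hr
      rw [(hg r).deriv]
      have : g' s < g' r := h2 ⟨hr.1, hr.2.trans (lt_of_lt_of_le ht2 (min_le_left _ _))⟩
      linarith
  exact this (Set.left_mem_Icc.2 ht1.le) (Set.right_mem_Icc.2 ht1.le) ht1

lemma aux_escape {g g' g'' : ℝ → ℝ} (hg : ∀ t, HasDerivAt g (g' t) t)
    (hg' : ∀ t, HasDerivAt g' (g'' t) t) {A c : ℝ} (hc : 0 < c)
    (hA : ∀ t, A ≤ g t → c ≤ g'' t) {t0 : ℝ} (h0 : A ≤ g t0) (h1 : 0 ≤ g' t0) :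
    Tendsto g atTop atTop := by
  have key : ∀ t1, t0 ≤ t1 → A ≤ g t1 := by
    intro t1 ht
    by_contra hlt
    push Not at hlt
    obtain ⟨s, hs, hmax⟩ := isCompact_Icc.exists_isMaxOn (Set.nonempty_Icc.2 ht)
      (fun t _ => (hg t).continuousAt.continuousWithinAt : ContinuousOn g (Set.Icc t0 t1))
    have hgs : A ≤ g s := h0.trans (hmax (Set.left_mem_Icc.2 ht))
    have hst : s < t1 := lt_of_le_of_ne hs.2 (by rintro rfl; linarith)
    have hs0 : 0 ≤ g' s := by
      rcases hs.1.eq_or_lt with h | h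
      · rwa [← h]
      · have : IsLocalMax g s := hmax.isLocalMax (Icc_mem_nhds h hst)
        rw [this.hasDerivAt_eq_zero (hg s)]
    obtain ⟨t, ht1, ht2, ht3⟩ := aux_second hg (hg' s) (lt_of_lt_of_le hc (hA s hgs)) hs0 hst
    have : g t ≤ g s := hmax ⟨hs.1.trans ht1.le, ht2.le⟩
    linarith
  have k2 : ∀ t, t0 + 1 ≤ t → c ≤ g' t := by
    intro t ht
    have := aux_grow hg' (a := t0) (b := t) (c := c) (by linarith)
      (fun r hr _ => hA r (key r hr))
    nlinarith
  have k3 : ∀ t, t0 + 1 ≤ t → g (t0+1) + c * (t - (t0+1)) ≤ g t := fun t ht =>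
    aux_grow hg ht (fun r hr _ => k2 r hr)
  refine tendsto_atTop_mono' _ (eventually_atTop.2 ⟨t0+1, k3⟩) ?_
  apply tendsto_atTop_add_const_left
  apply Tendsto.const_mul_atTop hc
  exact tendsto_atTop_add_const_right _ _ tendsto_id

lemma aux_trapped {g g' g'' : ℝ → ℝ} (hg : ∀ t, HasDerivAt g (g' t) t)
    (hg' : ∀ t, HasDerivAt g' (g'' t) t) {A c : ℝ} (hc : 0 < c)
    (hA : ∀ t, A ≤ g t → c ≤ g'' t) (hn : ¬ Tendsto g atTop atTop) :
    ∃ T, ∀ t, T ≤ t → g t ≤ A := by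
  have h1 : ∀ t, A ≤ g t → g' t < 0 := by
    intro t ht
    by_contra h
    exact hn (aux_escape hg hg' hc hA ht (not_lt.1 h))
  have h2 : ∃ T, g T < A := by
    by_contra h
    push Not at h
    have hT : 0 ≤ |g' 0| / c := by positivity
    have := aux_grow hg' (a := 0) (b := |g' 0| / c) (c := c) hT (fun r _ _ => hA r (h r))
    have h3 := h1 _ (h (|g' 0| / c))
    have : c * (|g' 0| / c - 0) = |g' 0| := by field_simp; ring
    linarith [neg_abs_le (g' 0)]
  obtain ⟨T, hT⟩ := h2
  refine ⟨T, fun t ht => ?_⟩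
  by_contra hlt
  push Not at hlt
  obtain ⟨s, hs, hmax⟩ := isCompact_Icc.exists_isMaxOn (Set.nonempty_Icc.2 ht)
    (fun t _ => (hg t).continuousAt.continuousWithinAt : ContinuousOn g (Set.Icc T t))
  have hgs : g t ≤ g s := hmax (Set.right_mem_Icc.2 ht)
  have hTs : T < s := lt_of_le_of_ne hs.1 (by rintro rfl; linarith)
  have h4 := aux_left (hg s) (h1 s (by linarith))
  have h5 : ∀ᶠ r in nhdsWithin s (Set.Iio s), r ∈ Set.Ioo T s := Ioo_mem_nhdsLT hTs
  obtain ⟨r, hr1, hr2⟩ := (h4.and h5).exists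
  have : g r ≤ g s := hmax ⟨hr2.1.le, hr2.2.le.trans hs.2⟩
  linarith

lemma aux_gronwall {X : Type*} [NormedAddCommGroup X] [NormedSpace ℝ X] {F : X → X} {K : NNReal}
    (hF : LipschitzWith K F) {x y : ℝ → X} (hx : ∀ t, HasDerivAt x (F (x t)) t)
    (hy : ∀ t, HasDerivAt y (F (y t)) t) (t : ℝ) :
    dist (x t) (y t) ≤ dist (x 0) (y 0) * Real.exp (K * |t|) := by
  rcases le_total 0 t with ht | ht
  · have := dist_le_of_trajectories_ODE (v := fun _ => F) (K := K) (a := 0) (b := t) (fun _ => hF)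
      (fun t _ => (hx t).continuousAt.continuousWithinAt) (fun t _ => (hx t).hasDerivWithinAt)
      (fun t _ => (hy t).continuousAt.continuousWithinAt) (fun t _ => (hy t).hasDerivWithinAt)
      le_rfl t ⟨ht, le_rfl⟩
    simpa [abs_of_nonneg ht] using this
  · have rev : ∀ {x : ℝ → X}, (∀ t, HasDerivAt x (F (x t)) t) → ∀ t,
        HasDerivAt (fun s => x (-s)) (-F (x (-t))) t := by
      intro x hx t
      simpa [Function.comp_def] using (hx (-t)).scomp t (hasDerivAt_neg t)
    have := dist_le_of_trajectories_ODE (v := fun _ => fun p => -F p) (K := K) (a := 0) (b := -t)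
      (fun _ => hF.neg)
      (fun t _ => (rev hx t).continuousAt.continuousWithinAt)
      (fun t _ => (rev hx t).hasDerivWithinAt)
      (fun t _ => (rev hy t).continuousAt.continuousWithinAt)
      (fun t _ => (rev hy t).hasDerivWithinAt)
      le_rfl (-t) ⟨by linarith, le_rfl⟩
    simpa [abs_of_nonpos ht] using this

lemma aux_limit {X : Type*} [NormedAddCommGroup X] [NormedSpace ℝ X] [CompleteSpace X]
    {F : X → X} {K : NNReal}
    (hF : LipschitzWith K F) {x : ℕ → ℝ → X} (hx : ∀ k t, HasDerivAt (x k) (F (x k t)) t)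
    {a : X} (ha : Tendsto (fun k => x k 0) atTop (nhds a)) :
    ∃ y : ℝ → X, (∀ t, HasDerivAt y (F (y t)) t) ∧
      ∀ t, Tendsto (fun k => x k t) atTop (nhds (y t)) := by
  have hC : ∀ t, ∃ b, Tendsto (fun k => x k t) atTop (nhds b) := by
    intro t
    apply cauchySeq_tendsto_of_complete
    rw [Metric.cauchySeq_iff]
    intro ε hε
    have hc := Metric.cauchySeq_iff.1 ha.cauchySeq (ε / Real.exp (K * |t|)) (by positivity)
    obtain ⟨N, hN⟩ := hc
    refine ⟨N, fun m hm n hn => ?_⟩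
    have := hN m hm n hn
    rw [lt_div_iff₀ (Real.exp_pos _)] at this
    exact lt_of_le_of_lt (aux_gronwall hF (hx m) (hx n) t) this
  choose y hy using hC
  refine ⟨y, fun t => ?_, hy⟩
  have ya : y 0 = a := tendsto_nhds_unique (hy 0) ha
  have hb : ∀ k t, dist (x k t) (y t) ≤ dist (x k 0) a * Real.exp (K * |t|) := by
    intro k t
    refine le_of_tendsto_of_tendsto (tendsto_const_nhds.dist (hy t))
      ((tendsto_const_nhds.dist ha).mul_const _) (Eventually.of_forall fun j => ?_)
    exact aux_gronwall hF (hx k) (hx j) t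
  refine hasDerivAt_of_tendstoUniformlyOn (l := atTop) (f := x) (f' := fun k t => F (x k t))
    (g' := fun t => F (y t)) (s := Metric.ball 0 (|t| + 1)) Metric.isOpen_ball ?_
    (Eventually.of_forall fun k s _ => hx k s) (fun s _ => hy s) (by simp)
  rw [Metric.tendstoUniformlyOn_iff]
  intro ε hε
  have h0 : Tendsto (fun k => (K : ℝ) * (dist (x k 0) a * Real.exp (K * (|t| + 1)))) atTop
      (nhds 0) := by
    simpa using ((tendsto_iff_dist_tendsto_zero.1 ha).mul_const (Real.exp (K * (|t| + 1)))).const_mul (K:ℝ)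
  filter_upwards [h0.eventually (gt_mem_nhds hε)] with k hk s hs
  have hs : |s| ≤ |t| + 1 := by simpa using (le_of_lt (by simpa using hs : |s| < |t| + 1))
  refine lt_of_le_of_lt ?_ hk
  rw [dist_comm]
  refine (hF.dist_le_mul _ _).trans ?_
  refine mul_le_mul_of_nonneg_left ((hb k s).trans ?_) K.2
  gcongr

lemma aux_inner_grad {n : ℕ} (V : EuclideanSpace ℝ (Fin n) → ℝ) (z w : EuclideanSpace ℝ (Fin n)) :
    inner ℝ (gradient V z) w = fderiv ℝ V z w := by
  unfold gradient
  exact InnerProductSpace.toDual_symm_apply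

lemma aux_norm_grad {n : ℕ} (V : EuclideanSpace ℝ (Fin n) → ℝ) (z : EuclideanSpace ℝ (Fin n)) :
    ‖gradient V z‖ = ‖fderiv ℝ V z‖ := by
  unfold gradient
  exact LinearIsometryEquiv.norm_map _ _

lemma aux_lip {n : ℕ} {V : EuclideanSpace ℝ (Fin n) → ℝ} (hV : IsLongRangePotential V) :
    ∃ K : NNReal, LipschitzWith K (gradient V) := by
  obtain ⟨hs, γ, hγ, hb⟩ := hV
  obtain ⟨C, hC, h2⟩ := hb 2
  refine ⟨1 * C.toNNReal, ?_⟩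
  have hd : Differentiable ℝ (fderiv ℝ V) :=
    (hs.fderiv_right (m := 1) (by norm_cast)).differentiable (by norm_num)
  have hl : LipschitzWith C.toNNReal (fderiv ℝ V) := by
    apply lipschitzWith_of_nnnorm_fderiv_le hd
    intro z
    rw [← NNReal.coe_le_coe, coe_nnnorm, Real.coe_toNNReal C hC.le, ← norm_iteratedFDeriv_one,
      norm_iteratedFDeriv_fderiv]
    refine (h2 z).trans (mul_le_of_le_one_right hC.le ?_)
    apply Real.rpow_le_one_of_one_le_of_nonpos
    · linarith [norm_nonneg z]
    · push_cast; linarith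
  have := (InnerProductSpace.toDual ℝ (EuclideanSpace ℝ (Fin n))).symm.lipschitz.comp hl
  exact this

lemma aux_far {n : ℕ} {V : EuclideanSpace ℝ (Fin n) → ℝ} (hV : IsLongRangePotential V)
    {ε : ℝ} (hε : 0 < ε) :
    ∃ R : ℝ, 0 < R ∧ ∀ z, R ≤ ‖z‖ → 8 * |V z| + 4 * |inner ℝ z (gradient V z)| ≤ ε := by
  obtain ⟨hs, γ, hγ, hb⟩ := hV
  obtain ⟨C0, hC0, h0⟩ := hb 0
  obtain ⟨C1, hC1, h1⟩ := hb 1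
  have ht : Tendsto (fun r : ℝ => (8 * C0 + 4 * C1) * (1 + r) ^ (-γ)) atTop (nhds 0) := by
    have := ((tendsto_rpow_neg_atTop hγ).comp
      (tendsto_atTop_add_const_left atTop (1:ℝ) tendsto_id)).const_mul (8 * C0 + 4 * C1)
    simpa [Function.comp_def] using this
  obtain ⟨R, hR⟩ := eventually_atTop.1 (ht.eventually (gt_mem_nhds hε))
  refine ⟨max R 1, by positivity, fun z hz => ?_⟩
  have hz1 := hR ‖z‖ ((le_max_left _ _).trans hz)
  have hp : (0:ℝ) < 1 + ‖z‖ := by positivity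
  have e0 : |V z| ≤ C0 * (1 + ‖z‖) ^ (-γ) := by
    have := h0 z
    rw [norm_iteratedFDeriv_zero, Real.norm_eq_abs] at this
    simpa using this
  have e1 : |inner ℝ z (gradient V z)| ≤ C1 * (1 + ‖z‖) ^ (-γ) := by
    have h := h1 z
    rw [norm_iteratedFDeriv_one, ← aux_norm_grad] at h
    have hm : (1 + ‖z‖) ^ (-γ - ((1:ℕ):ℝ)) * (1 + ‖z‖) = (1 + ‖z‖) ^ (-γ) := by
      rw [Nat.cast_one, Real.rpow_sub_one hp.ne']
      field_simp
    calc |inner ℝ z (gradient V z)| ≤ ‖z‖ * ‖gradient V z‖ := abs_real_inner_le_norm _ _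
      _ ≤ (1 + ‖z‖) * (C1 * (1 + ‖z‖) ^ (-γ - ((1:ℕ):ℝ))) := by
          gcongr; linarith
      _ = C1 * ((1 + ‖z‖) ^ (-γ - ((1:ℕ):ℝ)) * (1 + ‖z‖)) := by ring
      _ = _ := by rw [hm]
  nlinarith

lemma aux_energy {n : ℕ} {V : EuclideanSpace ℝ (Fin n) → ℝ} (hV : Differentiable ℝ V)
    {z ζ : ℝ → EuclideanSpace ℝ (Fin n)}
    (hz : ∀ t : ℝ, HasDerivAt z ((2 : ℝ) • ζ t) t)
    (hζ : ∀ t : ℝ, HasDerivAt ζ (-(gradient V (z t))) t) (t : ℝ) :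
    ‖ζ t‖ ^ 2 + V (z t) = ‖ζ 0‖ ^ 2 + V (z 0) := by
  have hd : ∀ t, HasDerivAt (fun t => ‖ζ t‖ ^ 2 + V (z t)) 0 t := by
    intro t
    have h1 := (hζ t).norm_sq
    have h2 := (hV (z t)).hasFDerivAt.comp_hasDerivAt t (hz t)
    have h3 := h1.add h2
    refine HasDerivAt.congr_deriv h3 ?_
    rw [inner_neg_right, real_inner_comm, aux_inner_grad, map_smul, smul_eq_mul]
    ring
  exact is_const_of_deriv_eq_zero (fun t => (hd t).differentiableAt) (fun t => (hd t).deriv) t 0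

lemma aux_bounded {n : ℕ} {V : EuclideanSpace ℝ (Fin n) → ℝ} (hV : Differentiable ℝ V)
    {lam R : ℝ} (hlam : 0 < lam) (hR : 0 < R)
    (hfar : ∀ z, R ≤ ‖z‖ → 8 * |V z| + 4 * |inner ℝ z (gradient V z)| ≤ lam)
    {z ζ : ℝ → EuclideanSpace ℝ (Fin n)}
    (hz : ∀ t : ℝ, HasDerivAt z ((2 : ℝ) • ζ t) t)
    (hζ : ∀ t : ℝ, HasDerivAt ζ (-(gradient V (z t))) t)
    (hE : lam / 2 ≤ ‖ζ 0‖ ^ 2 + V (z 0))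
    (hn : ¬ Tendsto (fun t => ‖z t‖) atTop atTop) :
    ∃ T, ∀ t, T ≤ t → ‖z t‖ ≤ R := by
  have hg : ∀ t, HasDerivAt (fun t => ‖z t‖ ^ 2) (4 * inner ℝ (z t) (ζ t)) t := by
    intro t
    have h1 := (hz t).norm_sq
    convert h1 using 1
    rw [inner_smul_right]; ring
  have hg' : ∀ t, HasDerivAt (fun t => 4 * inner ℝ (z t) (ζ t))
      (8 * ‖ζ t‖ ^ 2 - 4 * inner ℝ (z t) (gradient V (z t))) t := by
    intro t
    have h1 := ((hz t).inner ℝ (hζ t)).const_mul 4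
    refine HasDerivAt.congr_deriv h1 ?_
    rw [inner_smul_left, inner_neg_right, real_inner_self_eq_norm_sq]
    simp; ring
  have hA : ∀ t, R ^ 2 ≤ ‖z t‖ ^ 2 →
      lam ≤ 8 * ‖ζ t‖ ^ 2 - 4 * inner ℝ (z t) (gradient V (z t)) := by
    intro t ht
    have h1 : R ≤ ‖z t‖ := (sq_le_sq₀ hR.le (norm_nonneg _)).1 ht
    have h2 := hfar _ h1
    have h3 := aux_energy hV hz hζ t
    linarith [le_abs_self (V (z t)), le_abs_self (inner ℝ (z t) (gradient V (z t)))]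
  have hn' : ¬ Tendsto (fun t => ‖z t‖ ^ 2) atTop atTop := by
    intro h
    apply hn
    have := Real.tendsto_sqrt_atTop.comp h
    simpa [Function.comp_def] using this
  obtain ⟨T, hT⟩ := aux_trapped hg hg' hlam hA hn'
  exact ⟨T, fun t ht => (sq_le_sq₀ (norm_nonneg _) hR.le).1 (hT t ht)⟩

lemma aux_forward {n : ℕ}
    {V : EuclideanSpace ℝ (Fin n) → ℝ} (hV : IsLongRangePotential V)
    {lam₀ : ℝ} (hlam₀ : 0 < lam₀)
    (hnt : ∀ z ζ : ℝ → EuclideanSpace ℝ (Fin n),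
      (∀ t : ℝ, HasDerivAt z ((2 : ℝ) • ζ t) t) →
      (∀ t : ℝ, HasDerivAt ζ (-(gradient V (z t))) t) →
      ‖ζ 0‖ ^ 2 + V (z 0) = lam₀ →
      Tendsto (fun t => ‖z t‖) atTop atTop) :
    ∃ δ₀ : ℝ, 0 < δ₀ ∧
      ∀ z ζ : ℝ → EuclideanSpace ℝ (Fin n),
        (∀ t : ℝ, HasDerivAt z ((2 : ℝ) • ζ t) t) →
        (∀ t : ℝ, HasDerivAt ζ (-(gradient V (z t))) t) →
        (‖ζ 0‖ ^ 2 + V (z 0)) ∈ Set.Ioo (lam₀ - δ₀) (lam₀ + δ₀) →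
        Tendsto (fun t => ‖z t‖) atTop atTop := by
  have hd : Differentiable ℝ V := hV.1.differentiable (by simp)
  obtain ⟨K, hK⟩ := aux_lip hV
  obtain ⟨R, hR, hfar⟩ := aux_far hV hlam₀
  obtain ⟨C0, hC0, hVb⟩ : ∃ C0 : ℝ, 0 < C0 ∧ ∀ z, |V z| ≤ C0 := by
    obtain ⟨hs, γ, hγ, hb⟩ := hV
    obtain ⟨C0, hC0, h0⟩ := hb 0
    refine ⟨C0, hC0, fun z => ?_⟩
    have := h0 z
    rw [norm_iteratedFDeriv_zero, Real.norm_eq_abs] at this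
    refine this.trans (mul_le_of_le_one_right hC0.le ?_)
    apply Real.rpow_le_one_of_one_le_of_nonpos
    · linarith [norm_nonneg z]
    · push_cast; linarith
  by_contra hcon
  push Not at hcon
  -- trapped trajectories at nearby energies, shifted in time
  have step : ∀ k : ℕ, ∃ x : ℝ → EuclideanSpace ℝ (Fin n) × EuclideanSpace ℝ (Fin n),
      (∀ t, HasDerivAt x ((2:ℝ) • (x t).2, -(gradient V (x t).1)) t) ∧
      (|‖(x 0).2‖ ^ 2 + V (x 0).1 - lam₀| < (lam₀ / 2) * (1 / ((k:ℝ) + 1))) ∧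
      ∀ t, 0 ≤ t → ‖(x t).1‖ ≤ R := by
    intro k
    obtain ⟨z, ζ, hz, hζ, hE, hn⟩ := hcon ((lam₀ / 2) * (1 / ((k:ℝ) + 1))) (by positivity)
    have hk : (lam₀ / 2) * (1 / ((k:ℝ) + 1)) ≤ lam₀ / 2 := by
      apply mul_le_of_le_one_right (by positivity)
      rw [div_le_one (by positivity)]
      linarith [(Nat.cast_nonneg k : (0:ℝ) ≤ k)]
    obtain ⟨T, hT⟩ := aux_bounded hd hlam₀ hR hfar hz hζ (by linarith [hE.1]) hn
    refine ⟨fun t => (z (t + T), ζ (t + T)), fun t => ?_, ?_, fun t ht => hT _ (by linarith)⟩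
    · exact ((hz (t + T)).comp_add_const t T).prodMk ((hζ (t + T)).comp_add_const t T)
    · simp only [zero_add]
      rw [aux_energy hd hz hζ T, abs_lt]
      constructor <;> linarith [hE.1, hE.2]
  choose x hx hE hB using step
  have hcpt : ∀ k, x k 0 ∈ Metric.closedBall (0 : EuclideanSpace ℝ (Fin n)) R ×ˢ
      Metric.closedBall (0 : EuclideanSpace ℝ (Fin n)) (2 * lam₀ + C0 + 1) := by
    intro k
    refine ⟨by simpa using hB k 0 le_rfl, ?_⟩
    have hk : (lam₀ / 2) * (1 / ((k:ℝ) + 1)) ≤ lam₀ / 2 := by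
      apply mul_le_of_le_one_right (by positivity)
      rw [div_le_one (by positivity)]
      linarith [(Nat.cast_nonneg k : (0:ℝ) ≤ k)]
    have h1 := (abs_lt.1 (hE k)).2
    have h2 := (abs_le.1 (hVb (x k 0).1)).1
    simp only [Metric.mem_closedBall, dist_zero_right]
    nlinarith [norm_nonneg (x k 0).2]
  obtain ⟨a, -, φ, hφ, ha⟩ := ((isCompact_closedBall (0 : EuclideanSpace ℝ (Fin n)) R).prod
    (isCompact_closedBall (0 : EuclideanSpace ℝ (Fin n)) (2 * lam₀ + C0 + 1))).tendsto_subseq hcpt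
  have hF : ∃ K' : NNReal, LipschitzWith K'
      (fun p : EuclideanSpace ℝ (Fin n) × EuclideanSpace ℝ (Fin n) =>
        ((2:ℝ) • p.2, -(gradient V p.1))) :=
    ⟨_, ((lipschitzWith_smul (2:ℝ)).comp LipschitzWith.prod_snd).prodMk
      ((hK.comp LipschitzWith.prod_fst).neg)⟩
  obtain ⟨K', hF⟩ := hF
  obtain ⟨y, hy, hlim⟩ := aux_limit hF (x := fun k => x (φ k)) (fun k t => hx (φ k) t) ha
  have hE0 : ‖(y 0).2‖ ^ 2 + V (y 0).1 = lam₀ := by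
    have hc : Continuous (fun p : EuclideanSpace ℝ (Fin n) × EuclideanSpace ℝ (Fin n) =>
        ‖p.2‖ ^ 2 + V p.1) := by
      have := hd.continuous
      fun_prop
    have h1 := (hc.tendsto (y 0)).comp (hlim 0)
    refine tendsto_nhds_unique h1 ?_
    have h0 : Tendsto (fun k : ℕ => (lam₀ / 2) * (1 / ((k:ℝ) + 1))) atTop (nhds 0) := by
      simpa using tendsto_one_div_add_atTop_nhds_zero_nat.const_mul (lam₀ / 2)
    rw [tendsto_iff_dist_tendsto_zero]
    refine squeeze_zero (fun _ => dist_nonneg) (fun k => ?_) (h0.comp hφ.tendsto_atTop)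
    exact (hE (φ k)).le
  have hesc := hnt (fun t => (y t).1) (fun t => (y t).2) (fun t => (hy t).fst)
    (fun t => (hy t).snd) hE0
  have hbd : ∀ t, 0 ≤ t → ‖(y t).1‖ ≤ R := fun t ht =>
    le_of_tendsto (((continuous_fst.tendsto _).comp (hlim t)).norm)
      (Eventually.of_forall fun k => hB (φ k) t ht)
  obtain ⟨t, ht1, ht2⟩ := ((hesc.eventually (eventually_gt_atTop R)).and
    (eventually_ge_atTop 0)).exists
  exact absurd (hbd t ht2) (not_le.2 ht1)

/-- The set of non-trapping energies is open: if every global Hamiltonian trajectory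
with energy `λ₀` escapes to infinity in both time directions, then the same holds for
all energies in an interval `(λ₀ − δ₀, λ₀ + δ₀)`. -/
theorem nontrapping_is_open (n : ℕ) (hn : 1 ≤ n)
    (V : EuclideanSpace ℝ (Fin n) → ℝ) (hV : IsLongRangePotential V)
    (lam₀ : ℝ) (hlam₀ : 0 < lam₀)
    (hnt : ∀ z ζ : ℝ → EuclideanSpace ℝ (Fin n),
      (∀ t : ℝ, HasDerivAt z ((2 : ℝ) • ζ t) t) →
      (∀ t : ℝ, HasDerivAt ζ (-(gradient V (z t))) t) →
      ‖ζ 0‖ ^ 2 + V (z 0) = lam₀ →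
      Tendsto (fun t => ‖z t‖) atTop atTop ∧
        Tendsto (fun t => ‖z t‖) atBot atTop) :
    ∃ δ₀ : ℝ, 0 < δ₀ ∧
      ∀ z ζ : ℝ → EuclideanSpace ℝ (Fin n),
        (∀ t : ℝ, HasDerivAt z ((2 : ℝ) • ζ t) t) →
        (∀ t : ℝ, HasDerivAt ζ (-(gradient V (z t))) t) →
        (‖ζ 0‖ ^ 2 + V (z 0)) ∈ Set.Ioo (lam₀ - δ₀) (lam₀ + δ₀) →
        Tendsto (fun t => ‖z t‖) atTop atTop ∧
          Tendsto (fun t => ‖z t‖) atBot atTop := by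
  have rev : ∀ z ζ : ℝ → EuclideanSpace ℝ (Fin n),
      (∀ t : ℝ, HasDerivAt z ((2 : ℝ) • ζ t) t) →
      (∀ t : ℝ, HasDerivAt ζ (-(gradient V (z t))) t) →
      (∀ t : ℝ, HasDerivAt (fun s => z (-s)) ((2 : ℝ) • (fun s => -ζ (-s)) t) t) ∧
      (∀ t : ℝ, HasDerivAt (fun s => -ζ (-s)) (-(gradient V ((fun s => z (-s)) t))) t) := by
    intro z ζ hz hζ
    constructor
    · intro t
      simpa [Function.comp_def] using (hz (-t)).scomp t (hasDerivAt_neg t)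
    · intro t
      have h1 := ((hζ (-t)).scomp t (hasDerivAt_neg t)).neg
      refine HasDerivAt.congr_deriv h1 ?_
      simp
  obtain ⟨δ, hδ, h⟩ := aux_forward hV hlam₀ (fun z ζ h1 h2 h3 => (hnt z ζ h1 h2 h3).1)
  refine ⟨δ, hδ, fun z ζ hz hζ hE => ⟨h z ζ hz hζ hE, ?_⟩⟩
  obtain ⟨hz', hζ'⟩ := rev z ζ hz hζ
  have := (h _ _ hz' hζ' (by simpa using hE)).comp tendsto_neg_atBot_atTop
  simpa [Function.comp_def] using this
end

section
/- Let n ≥ 1, let V : ℝⁿ → ℝ be a smooth long-range potential, let λ > 0 and δ₀ > 0, and assume every global Hamiltonian trajectory with energy in (λ² − δ₀, λ² + δ₀) satisfies |z(t)| → ∞ as t → ±∞. Then for every ε ∈ (0, 1/4) there exist a smooth compactly supported function ψ : ℝ → [0, 1] with ψ ≡ 1 on a neighborhood of λ², a smooth function q : ℝⁿ × ℝⁿ → ℝ, and constants C, c′, c″ > 0 such that for all (z, ζ) ∈ ℝⁿ × ℝⁿ: (i) 0 ≤ q(z,ζ) ≤ C(1+|z|)^{ε}; (ii) q(z,ζ)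 ≥ c′(1+|z|)^{−ε}·ψ(p(z,ζ)); (iii) −(H_p q)(z,ζ) ≥ 0; and (iv) −(H_p q)(z,ζ) ≥ c″(1+|z|)^{−1−ε}·ψ(p(z,ζ)), where p(z,ζ) = |ζ|² + V(z) and H_p q = ∇_ζ p · ∇_z q − ∇_z p · ∇_ζ q = 2ζ·∇_z q − ∇V(z)·∇_ζ q. -/
open Filter

/-- The Hamiltonian derivative `H_p q = 2ζ·∇_z q − ∇V(z)·∇_ζ q` of a smooth function
`q` on phase space, for the Hamiltonian `p(z,ζ) = |ζ|² + V(z)`, expressed as the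
derivative of `q` in the direction of the Hamilton vector field `(2ζ, −∇V(z))`. -/
noncomputable def hamDeriv {n : ℕ} (V : EuclideanSpace ℝ (Fin n) → ℝ)
    (q : EuclideanSpace ℝ (Fin n) × EuclideanSpace ℝ (Fin n) → ℝ)
    (w : EuclideanSpace ℝ (Fin n) × EuclideanSpace ℝ (Fin n)) : ℝ :=
  fderiv ℝ q w ((2 : ℝ) • w.2, -(gradient V w.1))



theorem ef_flow_exists {E : Type*} [NormedAddCommGroup E] [NormedSpace ℝ E] [CompleteSpace E]
    (X : E → E) (K : NNReal) (hX : LipschitzWith K X) (hXs : ContDiff ℝ 1 X) :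
    ∃ φ : E → ℝ → E, (∀ w, φ w 0 = w) ∧ ∀ w t, HasDerivAt (φ w) (X (φ w t)) t := by
  have key : ∀ w : E, ∃ γ : ℝ → E, γ 0 = w ∧ ∀ t, HasDerivAt γ (X (γ t)) t := by
    intro w
    have hε : (0:ℝ) < 1 / (1 + K) := by positivity
    have := exists_isMIntegralCurve_of_isMIntegralCurveOn (I := modelWithCornersSelf ℝ E) (M := E)
      (v := X) (contMDiff_vectorSpace_iff_contDiff.2 hXs) (ε := 1 / (1 + K)) hε (by
        intro x
        have hP : IsPicardLindelof (fun _ ↦ X) (tmin := -(1 / (1 + K))) (tmax := 1 / (1 + K))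
            ⟨0, by constructor <;> linarith⟩ x (‖X x‖₊ + 1) 0 (‖X x‖₊ + K * (‖X x‖₊ + 1)) K := by
          apply IsPicardLindelof.of_time_independent
          · intro y hy
            have h1 := hX.dist_le_mul y x
            have h2 : dist y x ≤ ‖X x‖ + 1 := by simpa using hy
            have h3 : ‖X y‖ ≤ ‖X x‖ + dist (X y) (X x) := by
              rw [dist_eq_norm]
              have := norm_add_le (X x) (X y - X x)
              simpa using this
            have : (K:ℝ) * dist y x ≤ K * (‖X x‖ + 1) := by gcongr
            push_cast
            linarith
          · exact hX.lipschitzOnWith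
          · simp only [sub_zero, zero_sub, neg_neg, max_self]
            push_cast
            rw [mul_one_div, div_le_iff₀ (by positivity)]
            have := norm_nonneg (X x)
            have := K.2
            nlinarith [NNReal.coe_nonneg K]
        obtain ⟨γ, h0, hγ⟩ := hP.exists_eq_forall_mem_Icc_hasDerivWithinAt₀
        refine ⟨γ, h0, fun t ht => ?_⟩
        have := ((hγ t (Set.Ioo_subset_Icc_self ht)).mono Set.Ioo_subset_Icc_self).hasFDerivWithinAt
        have e : ContinuousLinearMap.toSpanSingleton ℝ (X (γ t))
            = (1 : ℝ →L[ℝ] ℝ).smulRight (X (γ t)) := by ext; simp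
        rw [e] at this
        exact this.hasMFDerivWithinAt) w
    obtain ⟨γ, h0, hγ⟩ := this
    refine ⟨γ, h0, fun t => ?_⟩
    have h : HasFDerivAt γ ((1 : ℝ →L[ℝ] ℝ).smulRight (X (γ t))) t :=
      hasMFDerivAt_iff_hasFDerivAt.1 (hγ t)
    exact h.hasDerivAt.congr_deriv (by simp)
  choose φ h1 h2 using key
  exact ⟨φ, h1, h2⟩

theorem ef_flow_lip {E : Type*} [NormedAddCommGroup E] [NormedSpace ℝ E]
    (X : E → E) (K : NNReal) (hX : LipschitzWith K X) (φ : E → ℝ → E) (h0 : ∀ w, φ w 0 = w)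
    (hφ : ∀ w t, HasDerivAt (φ w) (X (φ w t)) t) (w v : E) (t : ℝ) (ht : 0 ≤ t) :
    dist (φ w t) (φ v t) ≤ dist w v * Real.exp (K * t) := by
  have := dist_le_of_trajectories_ODE (v := fun _ => X) (K := K) (f := φ w) (g := φ v) (a := 0)
    (b := t) (δ := dist w v) (fun _ => hX)
    (fun s _ => (hφ w s).continuousAt.continuousWithinAt)
    (fun s _ => (hφ w s).hasDerivWithinAt)
    (fun s _ => (hφ v s).continuousAt.continuousWithinAt)
    (fun s _ => (hφ v s).hasDerivWithinAt) (by simp [h0]) t ⟨ht, le_rfl⟩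
  simpa using this

theorem ef_flow_add {E : Type*} [NormedAddCommGroup E] [NormedSpace ℝ E]
    (X : E → E) (K : NNReal) (hX : LipschitzWith K X) (φ : E → ℝ → E) (h0 : ∀ w, φ w 0 = w)
    (hφ : ∀ w t, HasDerivAt (φ w) (X (φ w t)) t) (w : E) (s t : ℝ) :
    φ (φ w s) t = φ w (t + s) := by
  have := ODE_solution_unique_univ (v := fun _ => X) (K := K) (s := fun _ => Set.univ)
    (f := φ (φ w s)) (g := fun t => φ w (t + s)) (t₀ := 0)
    (fun _ => hX.lipschitzOnWith) (fun t => ⟨hφ _ t, trivial⟩)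
    (fun t => ⟨(hφ w (t + s)).comp_add_const t s, trivial⟩) (by simp [h0])
  exact congrFun this t

theorem ef_b_lip {E : Type*} [NormedAddCommGroup E] [NormedSpace ℝ E]
    (X : E → E) (K : NNReal) (hX : LipschitzWith K X) (φ : E → ℝ → E) (h0 : ∀ w, φ w 0 = w)
    (hφ : ∀ w t, HasDerivAt (φ w) (X (φ w t)) t) (χ : E → ℝ) (L : NNReal) (hχ : LipschitzWith L χ)
    (T : ℝ) (hT : 0 ≤ T) :
    ∃ Λ : NNReal, LipschitzWith Λ (fun w => ∫ t in (0:ℝ)..T, χ (φ w t)) := by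
  have hc : ∀ w, Continuous (fun t => χ (φ w t)) := fun w =>
    hχ.continuous.comp (continuous_iff_continuousAt.2 fun t => (hφ w t).continuousAt)
  refine ⟨L * (Real.exp (K * T)).toNNReal * T.toNNReal, LipschitzWith.of_dist_le_mul fun w v => ?_⟩
  rw [dist_eq_norm, ← intervalIntegral.integral_sub ((hc w).intervalIntegrable _ _)
    ((hc v).intervalIntegrable _ _)]
  have := intervalIntegral.norm_integral_le_of_norm_le_const (a := 0) (b := T)
    (f := fun t => χ (φ w t) - χ (φ v t)) (C := L * (dist w v * Real.exp (K * T))) (by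
      intro t ht
      rw [Set.uIoc_of_le hT] at ht
      rw [← dist_eq_norm]
      refine (hχ.dist_le_mul _ _).trans ?_
      have h1 := ef_flow_lip X K hX φ h0 hφ w v t ht.1.le
      have h2 : Real.exp (K * t) ≤ Real.exp (K * T) := by
        gcongr; exact ht.2
      have h3 : dist w v * Real.exp (K * t) ≤ dist w v * Real.exp (K * T) := by gcongr
      have h4 := h1.trans h3
      gcongr)
  refine this.trans (le_of_eq ?_)
  rw [sub_zero, abs_of_nonneg hT]
  push_cast
  rw [Real.coe_toNNReal _ hT, Real.coe_toNNReal _ (Real.exp_pos _).le]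
  ring

theorem ef_b_deriv {E : Type*} [NormedAddCommGroup E] [NormedSpace ℝ E]
    (X : E → E) (K : NNReal) (hX : LipschitzWith K X) (φ : E → ℝ → E) (h0 : ∀ w, φ w 0 = w)
    (hφ : ∀ w t, HasDerivAt (φ w) (X (φ w t)) t) (χ : E → ℝ) (L : NNReal) (hχ : LipschitzWith L χ)
    (T : ℝ) (hT : 0 ≤ T) (w : E) :
    HasDerivAt (fun h : ℝ => ∫ t in (0:ℝ)..T, χ (φ (w + h • X w) t)) (χ (φ w T) - χ w) 0 := by
  have hc : ∀ w, Continuous (fun t => χ (φ w t)) := fun w =>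
    hχ.continuous.comp (continuous_iff_continuousAt.2 fun t => (hφ w t).continuousAt)
  obtain ⟨Λ, hΛ⟩ := ef_b_lip X K hX φ h0 hφ χ L hχ T hT
  set b : E → ℝ := fun w => ∫ t in (0:ℝ)..T, χ (φ w t) with hb
  have e1 : ∀ h, b (φ w h) = (∫ t in (0:ℝ)..(T + h), χ (φ w t)) - ∫ t in (0:ℝ)..h, χ (φ w t) := by
    intro h
    simp only [hb]
    simp_rw [ef_flow_add X K hX φ h0 hφ w h]
    rw [intervalIntegral.integral_comp_add_right (fun t => χ (φ w t)) h,
      intervalIntegral.integral_interval_sub_left ((hc w).intervalIntegrable _ _)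
      ((hc w).intervalIntegrable _ _), zero_add]
  have d1 : HasDerivAt (fun h => b (φ w h)) (χ (φ w T) - χ w) 0 := by
    simp_rw [e1]
    have a1 : HasDerivAt (fun u => ∫ t in (0:ℝ)..u, χ (φ w t)) (χ (φ w (T + 0))) (T + 0) :=
      (hc w).integral_hasStrictDerivAt 0 (T + 0) |>.hasDerivAt
    have a2 : HasDerivAt (fun u => ∫ t in (0:ℝ)..u, χ (φ w t)) (χ (φ w 0)) 0 :=
      (hc w).integral_hasStrictDerivAt 0 0 |>.hasDerivAt
    have a3 := (a1.comp_const_add T 0).sub a2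
    rw [h0, add_zero] at a3
    exact a3
  have d2 : HasDerivAt (fun h => b (w + h • X w) - b (φ w h)) 0 0 := by
    have a := hφ w 0
    rw [hasDerivAt_iff_isLittleO] at a ⊢
    simp only [h0, sub_zero, zero_smul, add_zero, sub_self, smul_zero] at a ⊢
    refine Asymptotics.IsBigO.trans_isLittleO (Asymptotics.IsBigO.of_bound Λ ?_) a
    filter_upwards with h
    rw [← dist_eq_norm]
    refine (hΛ.dist_le_mul _ _).trans (le_of_eq ?_)
    rw [dist_comm, dist_eq_norm]
    congr 2
    abel
  have := d1.add d2
  simp only [add_zero] at this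
  refine this.congr_of_eventuallyEq ?_
  filter_upwards with h
  simp [hb]

theorem ef_moll {E : Type*} [NormedAddCommGroup E] [NormedSpace ℝ E] [FiniteDimensional ℝ E]
    (X : E → E) (K : NNReal) (hX : LipschitzWith K X) (b : E → ℝ) (Λ : NNReal)
    (hb : LipschitzWith Λ b) (hb0 : ∀ w, 0 ≤ b w) (D : E → ℝ)
    (hD : ∀ w, HasDerivAt (fun h : ℝ => b (w + h • X w)) (D w) 0)
    (τ η : ℝ) (hτ : 0 < τ) (hη : 0 < η) :
    ∃ g : E → ℝ, ContDiff ℝ (⊤ : ℕ∞) g ∧ (∀ w, 0 ≤ g w) ∧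
      (∀ w B, (∀ v ∈ Metric.ball w η, b v ≤ B) → g w ≤ B) ∧
      (∀ w d, (∀ v ∈ Metric.ball w η, D v ≤ d) → fderiv ℝ g w (X w) ≤ d + τ) := by
  borelize E
  let μ : MeasureTheory.Measure E := MeasureTheory.Measure.addHaar
  obtain ⟨η', hη', hη'η, hη'τ⟩ : ∃ η' : ℝ, 0 < η' ∧ η' ≤ η ∧ Λ * (K * η') ≤ τ := by
    refine ⟨min η (τ / (Λ * K + 1)), by positivity, min_le_left _ _, ?_⟩
    calc (Λ:ℝ) * (K * min η (τ / (Λ * K + 1))) ≤ Λ * (K * (τ / (Λ * K + 1))) := by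
          gcongr; exact min_le_right _ _
      _ = (Λ * K) / (Λ * K + 1) * τ := by ring
      _ ≤ 1 * τ := by
          gcongr
          rw [div_le_one (by positivity)]; linarith
      _ = τ := one_mul _
  let ρ : ContDiffBump (0 : E) := ⟨η' / 2, η', by positivity, by linarith⟩
  let r : E → ℝ := ρ.normed μ
  have hr0 : ∀ t, 0 ≤ r t := fun t => ρ.nonneg_normed t
  have hr1 : ∫ t, r t ∂μ = 1 := ρ.integral_normed
  have hri : MeasureTheory.Integrable r μ := ρ.integrable_normed
  have hrc : Continuous r := ρ.continuous_normed
  have hrcs : HasCompactSupport r := ρ.hasCompactSupport_normed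
  have hrs : ∀ t, η' ≤ ‖t‖ → r t = 0 := by
    intro t ht
    by_contra h
    have : t ∈ Function.support (ρ.normed μ) := h
    rw [ρ.support_normed_eq] at this
    simp [ρ] at this
    linarith
  have hint : ∀ w, MeasureTheory.Integrable (fun t => r t * b (w - t)) μ := by
    intro w
    apply Continuous.integrable_of_hasCompactSupport
    · exact hrc.mul (hb.continuous.comp (continuous_const.sub continuous_id))
    · exact hrcs.mul_right
  let g : E → ℝ := fun w => ∫ t, r t * b (w - t) ∂μ
  have hg : ContDiff ℝ (⊤ : ℕ∞) g := by
    have := HasCompactSupport.contDiff_convolution_left (n := (⊤ : ℕ∞)) (μ := μ)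
      (ContinuousLinearMap.lsmul ℝ ℝ : ℝ →L[ℝ] ℝ →L[ℝ] ℝ) hrcs
      (ρ.contDiff_normed : ContDiff ℝ (⊤ : ℕ∞) (ρ.normed μ)) hb.continuous.locallyIntegrable
    exact this
  have hball : ∀ w t : E, ‖t‖ < η' → w - t ∈ Metric.ball w η := by
    intro w t ht
    rw [Metric.mem_ball, dist_eq_norm]
    simp
    linarith
  refine ⟨g, hg, fun w => ?_, fun w B hB => ?_, fun w d hd => ?_⟩
  · exact MeasureTheory.integral_nonneg fun t => mul_nonneg (hr0 t) (hb0 _)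
  · calc g w ≤ ∫ t, r t * B ∂μ := by
          apply MeasureTheory.integral_mono (hint w) (hri.mul_const B)
          intro t
          by_cases ht : ‖t‖ < η'
          · exact mul_le_mul_of_nonneg_left (hB _ (hball w t ht)) (hr0 t)
          · simp [hrs t (not_lt.1 ht)]
      _ = B := by rw [MeasureTheory.integral_mul_const, hr1, one_mul]
  · let f : E → ℝ := fun t => b (w - t)
    have hf : LipschitzWith Λ f := 
      LipschitzWith.of_dist_le_mul fun x y => by
        simpa only [f, dist_sub_left] using hb.dist_le_mul (w - x) (w - y)
    have L1 := hf.integral_inv_smul_sub_mul_tendsto_integral_lineDeriv_mul hri (-(X w))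
    have L2 : Tendsto (fun h : ℝ => h⁻¹ • (g (w + h • X w) - g w)) (nhdsWithin 0 (Set.Ioi 0))
        (nhds (fderiv ℝ g w (X w))) := by
      have := ((hg.differentiable (by simp)) w).hasFDerivAt.hasLineDerivAt (X w)
      have := this.tendsto_slope_zero_right
      simpa using this
    have L3 : ∀ h : ℝ, h⁻¹ • (g (w + h • X w) - g w)
        = ∫ t, (h⁻¹ • (f (t + h • (-(X w))) - f t)) * r t ∂μ := by
      intro h
      simp only [g]
      rw [← MeasureTheory.integral_sub (hint _) (hint _), ← MeasureTheory.integral_smul]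
      congr 1
      ext t
      have : w - (t + h • -(X w)) = w + h • X w - t := by
        rw [smul_neg]; abel
      simp only [f, this, smul_eq_mul]
      ring
    simp_rw [L3] at L2
    rw [tendsto_nhds_unique L2 L1]
    have hb1 : ∀ᵐ t ∂μ, lineDeriv ℝ f t (-(X w)) * r t ≤ (d + τ) * r t := by
      filter_upwards [hf.ae_lineDifferentiableAt (μ := μ) (-(X w))] with t ht
      by_cases htn : ‖t‖ < η'
      · refine mul_le_mul_of_nonneg_right ?_ (hr0 t)
        have a1 : HasDerivAt (fun h : ℝ => f (t + h • -(X w))) (lineDeriv ℝ f t (-(X w))) 0 :=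
          ht.hasLineDerivAt
        have a2 := hD (w - t)
        have a3 := a1.sub a2
        have a4 : ‖lineDeriv ℝ f t (-(X w)) - D (w - t)‖ ≤ Λ * (K * η') := by
          refine a3.le_of_lip' (by positivity) ?_
          filter_upwards with h
          simp only [Pi.sub_apply, zero_smul, add_zero, f, sub_self, sub_zero]
          have hh := hb.dist_le_mul (w - (t + h • -(X w))) (w - t + h • X (w - t))
          rw [dist_eq_norm] at hh
          refine hh.trans ?_
          rw [dist_eq_norm]
          have e : w - (t + h • -(X w)) - (w - t + h • X (w - t)) = h • (X w - X (w - t)) := by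
            rw [smul_neg, smul_sub]; abel
          rw [e, norm_smul]
          have h5 := hX.dist_le_mul w (w - t)
          rw [dist_eq_norm, dist_eq_norm, sub_sub_cancel] at h5
          have h6 : ‖X w - X (w - t)‖ ≤ K * η' := h5.trans (by gcongr)
          calc (Λ:ℝ) * (‖h‖ * ‖X w - X (w - t)‖) ≤ Λ * (‖h‖ * (K * η')) := by gcongr
            _ = _ := by ring
        have a5 := hd _ (hball w t htn)
        have a6 := (abs_le.1 (Real.norm_eq_abs _ ▸ a4)).2
        linarith
      · simp [hrs t (not_lt.1 htn)]
    calc ∫ t, lineDeriv ℝ f t (-(X w)) * r t ∂μ ≤ ∫ t, (d + τ) * r t ∂μ := by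
          apply MeasureTheory.integral_mono_ae ?_ (hri.const_mul _) hb1
          refine hri.bdd_mul (c := Λ * ‖-(X w)‖) ?_ ?_
          · exact (measurable_lineDeriv hf.continuous).aestronglyMeasurable
          · filter_upwards with t
            exact norm_lineDeriv_le_of_lipschitz ℝ hf
      _ = d + τ := by rw [MeasureTheory.integral_const_mul, hr1, mul_one]

theorem ef_pot {n : ℕ} (V : EuclideanSpace ℝ (Fin n) → ℝ) (hV : IsLongRangePotential V) :
    ∃ C0 : ℝ, 0 < C0 ∧ (∀ z, |V z| ≤ C0) ∧ (∀ z, ‖z‖ * ‖gradient V z‖ ≤ C0) ∧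
      (∀ κ : ℝ, 0 < κ → ∃ R : ℝ, 1 ≤ R ∧ ∀ z, R ≤ ‖z‖ →
        |V z| ≤ κ ∧ ‖z‖ * ‖gradient V z‖ ≤ κ) ∧
      (ContDiff ℝ (⊤ : ℕ∞) (gradient V)) ∧ ∃ K : NNReal, LipschitzWith K (gradient V) := by
  obtain ⟨hs, γ, hγ, hk⟩ := hV
  obtain ⟨A0, hA0, h0⟩ := hk 0
  obtain ⟨A1, hA1, h1⟩ := hk 1
  obtain ⟨A2, hA2, h2⟩ := hk 2
  have g1 : ∀ z, ‖gradient V z‖ = ‖fderiv ℝ V z‖ := fun z => by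
    simp [gradient]
  have b0 : ∀ z, |V z| ≤ (A0 + A1) * (1 + ‖z‖) ^ (-γ) := by
    intro z
    have := h0 z
    simp only [norm_iteratedFDeriv_zero, Nat.cast_zero, sub_zero, Real.norm_eq_abs] at this
    refine this.trans ?_
    gcongr
    linarith
  have b1 : ∀ z, ‖z‖ * ‖gradient V z‖ ≤ (A0 + A1) * (1 + ‖z‖) ^ (-γ) := by
    intro z
    have := h1 z
    rw [norm_iteratedFDeriv_one, ← g1, Real.rpow_sub (by positivity), Nat.cast_one,
      Real.rpow_one] at this
    have hz : (0:ℝ) < 1 + ‖z‖ := by positivity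
    calc ‖z‖ * ‖gradient V z‖ ≤ (1 + ‖z‖) * (A1 * ((1 + ‖z‖) ^ (-γ) / (1 + ‖z‖))) := by
          gcongr; linarith
      _ = A1 * (1 + ‖z‖) ^ (-γ) := by field_simp
      _ ≤ _ := by gcongr; linarith
  have b2 : ∀ z : EuclideanSpace ℝ (Fin n), (1 + ‖z‖) ^ (-γ) ≤ 1 := fun z =>
    Real.rpow_le_one_of_one_le_of_nonpos (by linarith [norm_nonneg z]) (by linarith)
  have b3 : ∀ z : EuclideanSpace ℝ (Fin n), (A0 + A1) * (1 + ‖z‖) ^ (-γ) ≤ A0 + A1 := fun z => by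
    have := b2 z
    nlinarith
  have hsm : ContDiff ℝ (⊤ : ℕ∞) (fderiv ℝ V) := hs.fderiv_right (by simp)
  refine ⟨A0 + A1, by positivity, fun z => (b0 z).trans (b3 z), fun z => (b1 z).trans (b3 z),
    ?_, ?_, ?_⟩
  · intro κ hκ
    have t1 : Tendsto (fun r : ℝ => (A0 + A1) * (1 + r) ^ (-γ)) atTop (nhds ((A0 + A1) * 0)) :=
      ((tendsto_rpow_neg_atTop hγ).comp (tendsto_atTop_add_const_left _ 1 tendsto_id)).const_mul _
    rw [mul_zero] at t1
    obtain ⟨R, hR⟩ := eventually_atTop.1 (t1.eventually (eventually_le_nhds hκ))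
    refine ⟨max R 1, le_max_right _ _, fun z hz => ?_⟩
    have := hR ‖z‖ ((le_max_left _ _).trans hz)
    exact ⟨(b0 z).trans this, (b1 z).trans this⟩
  · exact (InnerProductSpace.toDual ℝ (EuclideanSpace ℝ (Fin n))).symm.toContinuousLinearEquiv.contDiff.comp hsm
  · have l : LipschitzWith A2.toNNReal (fderiv ℝ V) := by
      apply lipschitzWith_of_nnnorm_fderiv_le (𝕜 := ℝ) (hsm.differentiable (by simp))
      intro z
      rw [← NNReal.coe_le_coe, Real.coe_toNNReal _ hA2.le, coe_nnnorm, ← norm_iteratedFDeriv_one,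
        norm_iteratedFDeriv_fderiv]
      refine (h2 z).trans ?_
      have : (1 + ‖z‖) ^ (-γ - ((2:ℕ):ℝ)) ≤ 1 :=
        Real.rpow_le_one_of_one_le_of_nonpos (by linarith [norm_nonneg z]) (by push_cast; linarith)
      nlinarith
    refine ⟨A2.toNNReal, ?_⟩
    have := (InnerProductSpace.toDual ℝ (EuclideanSpace ℝ (Fin n))).symm.lipschitz.comp l
    rw [one_mul] at this
    exact this

theorem ef_field {n : ℕ} (V : EuclideanSpace ℝ (Fin n) → ℝ)
    (h1 : ContDiff ℝ (⊤ : ℕ∞) (gradient V)) (K : NNReal) (h2 : LipschitzWith K (gradient V)) :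
    ContDiff ℝ 1 (fun w : EuclideanSpace ℝ (Fin n) × EuclideanSpace ℝ (Fin n) =>
      (((2 : ℝ) • w.2, -(gradient V w.1)) :
        EuclideanSpace ℝ (Fin n) × EuclideanSpace ℝ (Fin n))) ∧
    LipschitzWith (max 2 K) (fun w : EuclideanSpace ℝ (Fin n) × EuclideanSpace ℝ (Fin n) =>
      (((2 : ℝ) • w.2, -(gradient V w.1)) :
        EuclideanSpace ℝ (Fin n) × EuclideanSpace ℝ (Fin n))) := by
  constructor
  · have h1' : ContDiff ℝ 1 (gradient V) := h1.of_le (by exact_mod_cast le_top)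
    exact (contDiff_snd.const_smul (2:ℝ)).prodMk (h1'.comp contDiff_fst).neg
  · apply LipschitzWith.prodMk
    · refine LipschitzWith.of_dist_le_mul fun w v => ?_
      rw [dist_smul₀]
      have : dist w.2 v.2 ≤ dist w v := le_max_right _ _
      simpa using this
    · refine LipschitzWith.of_dist_le_mul fun w v => ?_
      rw [dist_neg_neg]
      refine (h2.dist_le_mul _ _).trans ?_
      have : dist w.1 v.1 ≤ dist w v := le_max_left _ _
      gcongr

theorem ef_barrier (m s d : ℝ → ℝ) (R : ℝ) (hm : ∀ t, HasDerivAt m (4 * s t) t)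
    (hs : ∀ t, HasDerivAt s (d t) t) (hd : ∀ t, R ≤ m t → 0 < d t) (t0 : ℝ) (h0 : R ≤ m t0)
    (hs0 : 0 < s t0) : ∀ t, t0 ≤ t → m t0 ≤ m t := by
  have hsc : Continuous s := continuous_iff_continuousAt.2 fun t => (hs t).continuousAt
  have hmc : Continuous m := continuous_iff_continuousAt.2 fun t => (hm t).continuousAt
  have mono : ∀ τ, t0 ≤ τ → (∀ t ∈ Set.Ioo t0 τ, 0 ≤ s t) → ∀ t ∈ Set.Icc t0 τ, m t0 ≤ m t := by
    intro τ hτ h t ht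
    have : MonotoneOn m (Set.Icc t0 τ) := by
      apply monotoneOn_of_deriv_nonneg (convex_Icc _ _) hmc.continuousOn
      · exact fun t _ => (hm t).differentiableAt.differentiableWithinAt
      · intro t ht
        rw [interior_Icc] at ht
        rw [(hm t).deriv]
        have := h t ht
        positivity
    exact this ⟨le_rfl, hτ⟩ ht ht.1
  have pos : ∀ t, t0 ≤ t → 0 < s t := by
    by_contra hcon
    push Not at hcon
    obtain ⟨t1, ht1, hst1⟩ := hcon
    have hA : IsCompact (Set.Icc t0 t1 ∩ {t | s t ≤ 0}) :=
      isCompact_Icc.inter_right (isClosed_le hsc continuous_const)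
    obtain ⟨τ, ⟨hτ1, hτ2⟩, hτ3⟩ := hA.exists_isLeast ⟨t1, ⟨ht1, le_rfl⟩, hst1⟩
    have hτ2 : s τ ≤ 0 := hτ2
    have hnn : ∀ t ∈ Set.Ioo t0 τ, 0 ≤ s t := by
      intro t ht
      by_contra hc
      have := hτ3 ⟨⟨ht.1.le, ht.2.le.trans hτ1.2⟩, (not_le.1 hc).le⟩
      linarith [ht.2]
    have hm2 := mono τ hτ1.1 hnn
    have : MonotoneOn s (Set.Icc t0 τ) := by
      apply monotoneOn_of_deriv_nonneg (convex_Icc _ _) hsc.continuousOn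
      · exact fun t _ => (hs t).differentiableAt.differentiableWithinAt
      · intro t ht
        rw [interior_Icc] at ht
        rw [(hs t).deriv]
        exact (hd t (h0.trans (hm2 t (Set.Ioo_subset_Icc_self ht)))).le
    have := this ⟨le_rfl, hτ1.1⟩ ⟨hτ1.1, le_rfl⟩ hτ1.1
    linarith
  intro t ht
  exact mono t ht (fun u hu => (pos u hu.1.le).le) t ⟨ht, le_rfl⟩

/-- Phase space. -/
abbrev EFP (n : ℕ) := EuclideanSpace ℝ (Fin n) × EuclideanSpace ℝ (Fin n)

/-- The Hamilton vector field. -/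
noncomputable def efX {n : ℕ} (V : EuclideanSpace ℝ (Fin n) → ℝ) (w : EFP n) : EFP n :=
  ((2 : ℝ) • w.2, -(gradient V w.1))

/-- The energy. -/
noncomputable def efp {n : ℕ} (V : EuclideanSpace ℝ (Fin n) → ℝ) (w : EFP n) : ℝ :=
  ‖w.2‖ ^ 2 + V w.1

/-- The derivative of `z·ζ` along the flow. -/
noncomputable def efd {n : ℕ} (V : EuclideanSpace ℝ (Fin n) → ℝ) (w : EFP n) : ℝ :=
  2 * ‖w.2‖ ^ 2 - inner ℝ w.1 (gradient V w.1)

theorem ef_curve {n : ℕ} (V : EuclideanSpace ℝ (Fin n) → ℝ) (hV : Differentiable ℝ V)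
    (c : ℝ → EFP n) (hc : ∀ t, HasDerivAt c (efX V (c t)) t) :
    (∀ t, HasDerivAt (fun t => ‖(c t).1‖ ^ 2) (4 * inner ℝ (c t).1 (c t).2) t) ∧
    (∀ t, HasDerivAt (fun t => inner ℝ (c t).1 (c t).2) (efd V (c t)) t) ∧
    (∀ t, efp V (c t) = efp V (c 0)) := by
  have h1 : ∀ t, HasDerivAt (fun t => (c t).1) ((2 : ℝ) • (c t).2) t := fun t =>
    ((hasFDerivAt_fst (𝕜 := ℝ) (p := c t)).comp_hasDerivAt t (hc t))
  have h2 : ∀ t, HasDerivAt (fun t => (c t).2) (-(gradient V (c t).1)) t := fun t =>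
    ((hasFDerivAt_snd (𝕜 := ℝ) (p := c t)).comp_hasDerivAt t (hc t))
  refine ⟨fun t => ?_, fun t => ?_, ?_⟩
  · refine (h1 t).norm_sq.congr_deriv ?_
    rw [inner_smul_right]; ring
  · refine ((h1 t).inner ℝ (h2 t)).congr_deriv ?_
    rw [inner_smul_left, inner_neg_right, real_inner_self_eq_norm_sq, efd]
    simp
    ring
  · have hd : ∀ t, HasDerivAt (fun t => efp V (c t)) 0 t := by
      intro t
      have a := (h2 t).norm_sq
      have b : HasDerivAt (fun t => V (c t).1) (fderiv ℝ V (c t).1 ((2 : ℝ) • (c t).2)) t :=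
        (hV (c t).1).hasFDerivAt.comp_hasDerivAt t (h1 t)
      refine (a.add b).congr_deriv ?_
      have e : fderiv ℝ V (c t).1 ((2 : ℝ) • (c t).2)
          = inner ℝ (gradient V (c t).1) ((2 : ℝ) • (c t).2) := by
        simp only [gradient]
        rw [InnerProductSpace.toDual_symm_apply]
      rw [e, inner_smul_right, inner_neg_right, real_inner_comm]
      ring
    intro t
    exact is_const_of_deriv_eq_zero (fun t => (hd t).differentiableAt) (fun t => (hd t).deriv) t 0

theorem ef_shell_compact {n : ℕ} (V : EuclideanSpace ℝ (Fin n) → ℝ) (hV : Continuous V) (C0 : ℝ)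
    (hC0 : ∀ z, |V z| ≤ C0) (e δ R : ℝ) :
    IsCompact {w : EFP n | ‖w.1‖ ≤ R ∧ |efp V w - e| ≤ δ} := by
  have hp : Continuous (efp V) := by unfold efp; fun_prop
  apply Metric.isCompact_of_isClosed_isBounded
  · have h1 : IsClosed {w : EFP n | ‖w.1‖ ≤ R} := isClosed_le (by fun_prop) continuous_const
    have h2 : IsClosed {w : EFP n | |efp V w - e| ≤ δ} :=
      isClosed_le (by fun_prop) continuous_const
    exact h1.inter h2
  · refine (Metric.isBounded_closedBall (x := (0 : EFP n)) (r := max R (1 + (e + δ + C0)))).subset ?_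
    rintro w ⟨h1, h2⟩
    rw [mem_closedBall_zero_iff, Prod.norm_def]
    refine max_le_max h1 ?_
    have h3 := (abs_le.1 h2).2
    have h4 := (abs_le.1 (hC0 w.1)).1
    unfold efp at h3
    nlinarith [sq_nonneg (‖w.2‖ - 1), norm_nonneg w.2]

theorem ef_escape {n : ℕ} (V : EuclideanSpace ℝ (Fin n) → ℝ) (hV : Differentiable ℝ V) (C0 : ℝ)
    (hC0 : ∀ z, |V z| ≤ C0) (K : NNReal) (hX : LipschitzWith K (efX V)) (φ : EFP n → ℝ → EFP n)
    (h0 : ∀ w, φ w 0 = w) (hφ : ∀ w t, HasDerivAt (φ w) (efX V (φ w t)) t)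
    (e δ R0 : ℝ) (hR00 : 0 ≤ R0)
    (hR0 : ∀ w : EFP n, R0 ≤ ‖w.1‖ → |efp V w - e| ≤ δ → 0 < efd V w)
    (hnt : ∀ w, |efp V w - e| ≤ δ → Tendsto (fun t => ‖(φ w t).1‖) atTop atTop)
    (R : ℝ) (hR : R0 ≤ R) :
    ∃ T : ℝ, 0 ≤ T ∧ ∀ w : EFP n, ‖w.1‖ ≤ R → |efp V w - e| ≤ δ → ∀ t, T ≤ t →
      R < ‖(φ w t).1‖ := by
  have hcont : ∀ t, 0 ≤ t → Continuous (fun w => φ w t) := by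
    intro t ht
    have : LipschitzWith (Real.exp (K * t)).toNNReal (fun w => φ w t) :=
      LipschitzWith.of_dist_le_mul fun w v => by
        rw [Real.coe_toNNReal _ (Real.exp_pos _).le, mul_comm]
        exact ef_flow_lip _ K hX φ h0 hφ w v t ht
    exact this.continuous
  have hcur := fun w => ef_curve V hV (φ w) (hφ w)
  -- the barrier
  have hbar : ∀ w, |efp V w - e| ≤ δ → ∀ t0, R < ‖(φ w t0).1‖ →
      0 < inner ℝ (φ w t0).1 (φ w t0).2 → ∀ t, t0 ≤ t → R < ‖(φ w t).1‖ := by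
    intro w hw t0 h1 h2 t ht
    obtain ⟨c1, c2, c3⟩ := hcur w
    have := ef_barrier (fun t => ‖(φ w t).1‖ ^ 2) (fun t => inner ℝ (φ w t).1 (φ w t).2)
      (fun t => efd V (φ w t)) (R0 ^ 2) c1 c2 (by
        intro t ht
        apply hR0 _ (abs_le_of_sq_le_sq' ht (norm_nonneg _)).2
        rw [c3, h0]; exact hw) t0 (by
        have := hR.trans h1.le
        exact pow_le_pow_left₀ hR00 this 2) h2 t ht
    exact h1.trans_le (abs_le_of_sq_le_sq' this (norm_nonneg _)).2
  -- pointwise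
  have hpt : ∀ w, |efp V w - e| ≤ δ → ∃ t0, 0 ≤ t0 ∧ R < ‖(φ w t0).1‖ ∧
      0 < inner ℝ (φ w t0).1 (φ w t0).2 := by
    intro w hw
    obtain ⟨c1, c2, c3⟩ := hcur w
    obtain ⟨t1, ht1⟩ := eventually_atTop.1 ((hnt w hw).eventually_gt_atTop R)
    by_contra hcon
    push Not at hcon
    set t2 := max t1 0 with ht2
    have hanti : AntitoneOn (fun t => ‖(φ w t).1‖ ^ 2) (Set.Ici t2) := by
      apply antitoneOn_of_deriv_nonpos (convex_Ici _)
      · exact fun t _ => (c1 t).continuousAt.continuousWithinAt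
      · exact fun t _ => (c1 t).differentiableAt.differentiableWithinAt
      · intro t ht
        rw [interior_Ici] at ht
        have ht : t2 < t := ht
        rw [(c1 t).deriv]
        have := hcon t ((le_max_right _ _).trans ht.le) (ht1 t ((le_max_left _ _).trans ht.le))
        linarith
    obtain ⟨t3, ht3⟩ := eventually_atTop.1 ((hnt w hw).eventually_gt_atTop ‖(φ w t2).1‖)
    have a := hanti (Set.mem_Ici.2 le_rfl) (Set.mem_Ici.2 (le_max_right t3 t2)) (le_max_right t3 t2)
    have b := ht3 (max t3 t2) (le_max_left _ _)
    have c := norm_nonneg (φ w t2).1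
    simp only at a
    nlinarith
  have hK := ef_shell_compact V hV.continuous C0 hC0 e δ R
  let U : ℝ → Set (EFP n) := fun t0 => {w | 0 ≤ t0 ∧ R < ‖(φ w t0).1‖ ∧
    0 < inner ℝ (φ w t0).1 (φ w t0).2}
  have hU : ∀ t0, IsOpen (U t0) := by
    intro t0
    by_cases ht0 : 0 ≤ t0
    · have := hcont t0 ht0
      simp only [U, ht0, true_and]
      have h1 : IsOpen {w : EFP n | R < ‖(φ w t0).1‖} :=
        isOpen_lt continuous_const (by fun_prop)
      have h2 : IsOpen {w : EFP n | 0 < inner ℝ (φ w t0).1 (φ w t0).2} :=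
        isOpen_lt continuous_const (by fun_prop)
      exact h1.inter h2
    · simp [U, ht0]
  obtain ⟨s, hs⟩ := hK.elim_finite_subcover U hU (by
    rintro w ⟨_, hw⟩
    obtain ⟨t0, h⟩ := hpt w hw
    exact Set.mem_iUnion.2 ⟨t0, h⟩)
  obtain ⟨T, hT⟩ := s.bddAbove
  refine ⟨max T 0, le_max_right _ _, fun w h1 h2 t ht => ?_⟩
  obtain ⟨t0, ht0s, ht0⟩ := Set.mem_iUnion₂.1 (hs ⟨h1, h2⟩)
  exact hbar w h2 t0 ht0.2.1 ht0.2.2 t ((hT ht0s).trans ((le_max_left _ _).trans ht))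

theorem ef_bbound {n : ℕ} (V : EuclideanSpace ℝ (Fin n) → ℝ) (hV : Differentiable ℝ V)
    (K : NNReal) (hX : LipschitzWith K (efX V)) (φ : EFP n → ℝ → EFP n)
    (h0 : ∀ w, φ w 0 = w) (hφ : ∀ w t, HasDerivAt (φ w) (efX V (φ w t)) t)
    (e δ R T1 : ℝ) (hT10 : 0 ≤ T1)
    (hT1 : ∀ w : EFP n, ‖w.1‖ ≤ R → |efp V w - e| ≤ δ → ∀ t, T1 ≤ t → R < ‖(φ w t).1‖)
    (χ : EFP n → ℝ) (hχc : Continuous χ) (hχ1 : ∀ w, χ w ≤ 1)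
    (hχR : ∀ w : EFP n, R < ‖w.1‖ → χ w = 0) (T : ℝ) (hT : 0 ≤ T) (w : EFP n)
    (hw : |efp V w - e| ≤ δ) : ∫ t in (0:ℝ)..T, χ (φ w t) ≤ T1 := by
  have hφc : Continuous (φ w) := continuous_iff_continuousAt.2 fun t => (hφ w t).continuousAt
  obtain ⟨c1, c2, c3⟩ := ef_curve V hV (φ w) (hφ w)
  by_cases hne : (Set.Icc 0 T ∩ {t | ‖(φ w t).1‖ ≤ R}).Nonempty
  · have hA : IsCompact (Set.Icc 0 T ∩ {t | ‖(φ w t).1‖ ≤ R}) :=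
      isCompact_Icc.inter_right (isClosed_le (by fun_prop) continuous_const)
    obtain ⟨t0, ⟨ht01, ht02⟩, ht03⟩ := hA.exists_isLeast hne
    have hz : ∀ t ∈ Set.Ioc 0 T,
        χ (φ w t) ≤ (Set.Icc t0 (t0 + T1)).indicator (fun _ => (1:ℝ)) t := by
      intro t ht
      by_cases hm : t ∈ Set.Icc t0 (t0 + T1)
      · rw [Set.indicator_of_mem hm]; exact hχ1 _
      · rw [Set.indicator_of_notMem hm]
        refine (hχR _ ?_).le
        rw [Set.mem_Icc, not_and_or, not_le, not_le] at hm
        rcases hm with hm | hm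
        · by_contra hc
          have := ht03 ⟨⟨ht.1.le, ht.2⟩, not_lt.1 hc⟩
          linarith
        · have := hT1 (φ w t0) ht02 (by rw [c3, h0]; exact hw) (t - t0) (by linarith)
          rw [ef_flow_add _ K hX φ h0 hφ w t0, sub_add_cancel] at this
          exact this
    have hii : MeasureTheory.Integrable ((Set.Icc t0 (t0 + T1)).indicator (fun _ => (1:ℝ))) :=
      (MeasureTheory.integrable_indicator_iff measurableSet_Icc).2
        (MeasureTheory.integrableOn_const (by simp))
    rw [intervalIntegral.integral_of_le hT]
    calc ∫ t in Set.Ioc 0 T, χ (φ w t)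
        ≤ ∫ t in Set.Ioc 0 T, (Set.Icc t0 (t0 + T1)).indicator (fun _ => (1:ℝ)) t := by
          apply MeasureTheory.setIntegral_mono_on _ hii.integrableOn measurableSet_Ioc hz
          exact ((hχc.comp hφc).integrableOn_Icc).mono_set Set.Ioc_subset_Icc_self
      _ ≤ ∫ t, (Set.Icc t0 (t0 + T1)).indicator (fun _ => (1:ℝ)) t := by
          apply MeasureTheory.setIntegral_le_integral hii
          filter_upwards with t
          exact Set.indicator_nonneg (fun _ _ => zero_le_one) t
      _ = T1 := by
          rw [MeasureTheory.integral_indicator measurableSet_Icc]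
          simp [hT10]
  · have : ∫ t in (0:ℝ)..T, χ (φ w t) = ∫ t in (0:ℝ)..T, (0:ℝ) := by
      apply intervalIntegral.integral_congr
      intro t ht
      rw [Set.uIcc_of_le hT] at ht
      apply hχR
      by_contra hc
      exact hne ⟨t, ht, not_lt.1 hc⟩
    rw [this]
    simpa using hT10

theorem ef_F (ε : ℝ) (h0 : 0 < ε) (h1 : ε < 1) (s : ℝ) :
    HasDerivAt (fun s => Real.exp (-ε * Real.arsinh s))
      (-(ε * Real.exp (-ε * Real.arsinh s) / √(1 + s ^ 2))) s ∧
    (2 * √(1 + s ^ 2)) ^ (-ε) ≤ Real.exp (-ε * Real.arsinh s) ∧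
    Real.exp (-ε * Real.arsinh s) ≤ (2 * √(1 + s ^ 2)) ^ ε ∧
    (s ≤ 0 → √(1 + s ^ 2) ^ ε ≤ Real.exp (-ε * Real.arsinh s)) := by
  have hJ1 : 1 ≤ √(1 + s ^ 2) := Real.one_le_sqrt.2 (by nlinarith [sq_nonneg s])
  have hJs : |s| ≤ √(1 + s ^ 2) := Real.abs_le_sqrt (by linarith)
  have hs := abs_le.1 hJs
  have hJ2 : √(1 + s ^ 2) ^ 2 = 1 + s ^ 2 := Real.sq_sqrt (by positivity)
  set J := √(1 + s ^ 2) with hJ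
  have hE : Real.exp (-ε * Real.arsinh s) = (J - s) ^ ε := by
    have : Real.exp (-Real.arsinh s) = J - s := by
      rw [← Real.arsinh_neg, Real.exp_arsinh]
      simp [hJ]; ring
    rw [← this, ← Real.exp_mul]; congr 1; ring
  have hpos : 0 < J - s := by
    have : 0 < (J - s) * (J + s) := by nlinarith
    by_contra hc
    nlinarith
  refine ⟨?_, ?_, ?_, ?_⟩
  · have := ((Real.hasDerivAt_arsinh s).const_mul (-ε)).exp
    refine this.congr_deriv ?_
    rw [← hJ]
    field_simp
  · rw [hE, Real.rpow_neg (by positivity), ← Real.inv_rpow (by positivity)]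
    refine Real.rpow_le_rpow (by positivity) ?_ h0.le
    rw [inv_le_iff_one_le_mul₀ (by positivity)]
    nlinarith
  · rw [hE]
    exact Real.rpow_le_rpow hpos.le (by linarith) h0.le
  · intro h
    rw [hE]
    exact Real.rpow_le_rpow (by positivity) (by linarith) h0.le

theorem ef_st : (∀ x, 0 ≤ deriv Real.smoothTransition x) ∧
    (∀ x, 1 ≤ x → deriv Real.smoothTransition x = 0) ∧
    (∀ x, x ≤ 0 → deriv Real.smoothTransition x = 0) ∧
    ∃ D : ℝ, 0 < D ∧ ∀ x, deriv Real.smoothTransition x ≤ D := by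
  have hm : ∀ x, 1 ≤ x → deriv Real.smoothTransition x = 0 := by
    intro x hx
    apply IsLocalMax.deriv_eq_zero
    filter_upwards with y
    rw [Real.smoothTransition.one_of_one_le hx]
    exact Real.smoothTransition.le_one y
  have hm' : ∀ x, x ≤ 0 → deriv Real.smoothTransition x = 0 := by
    intro x hx
    apply IsLocalMin.deriv_eq_zero
    filter_upwards with y
    rw [Real.smoothTransition.zero_of_nonpos hx]
    exact Real.smoothTransition.nonneg y
  refine ⟨fun x => Real.smoothTransition.monotone.deriv_nonneg, hm, hm', ?_⟩
  have hc : Continuous (deriv Real.smoothTransition) :=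
    (Real.smoothTransition.contDiff (n := 1)).continuous_deriv le_rfl
  obtain ⟨D, hD⟩ := (isCompact_Icc (a := (0:ℝ)) (b := 1)).bddAbove_image hc.continuousOn
  refine ⟨max D 1, by positivity, fun x => ?_⟩
  by_cases h : x ∈ Set.Icc (0:ℝ) 1
  · exact (hD ⟨x, h, rfl⟩).trans (le_max_left _ _)
  · rw [Set.mem_Icc, not_and_or, not_le, not_le] at h
    rcases h with h | h
    · rw [hm' x h.le]; positivity
    · rw [hm x h.le]; positivity

set_option maxHeartbeats 1600000 in
theorem ef_ineq (ε c0 A B D Z1 R0 R2 M τ : ℝ) (hε : 0 < ε) (hε1 : ε < 1) (hc0 : 0 < c0)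
    (hA : 0 ≤ A) (hB : 0 ≤ B) (hD : 0 < D) (hZ1 : 1 ≤ Z1) (hR2 : 1 ≤ R2) (hR02 : R0 ≤ R2)
    (hM : M = 2 * (2 * A + 1)) (hR2' : 8 * M * B * D * (3 * Z1) ^ 2 ≤ c0 * ε * R2 ^ ε)
    (hτ : 0 < τ) (hτ1 : τ ≤ 1 / 2)
    (hτ2 : M * τ ≤ (c0 * ε * 2 ^ (-ε) * Z1 ^ (-1 - ε)) / 4 * (1 + 2 * R2) ^ (-1 - ε))
    (r s d g hg θ θ' F : ℝ) (hr : 0 ≤ r)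
    (hJ : √(1 + s ^ 2) ≤ Z1 * (1 + r))
    (hF1 : (2 * √(1 + s ^ 2)) ^ (-ε) ≤ F) (hF2 : F ≤ (2 * √(1 + s ^ 2)) ^ ε)
    (hF3 : s ≤ 0 → √(1 + s ^ 2) ^ ε ≤ F)
    (hd : |d| ≤ A) (hd1 : R0 ≤ r → c0 ≤ d)
    (hθ0 : 0 ≤ θ) (hθ1 : θ ≤ 1) (hθR : r ≤ R2 → θ = 1) (hθR' : r ≤ R2 → θ' = 0)
    (hθ'0 : 0 ≤ θ') (hθ'D : θ' ≤ D)
    (hθ2 : 2 * R2 ≤ r → θ = 0 ∧ θ' = 0)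
    (hg0 : 0 ≤ g) (hgB : r ≤ 2 * R2 → g ≤ B)
    (hg1 : r ≤ R0 → hg ≤ -1 + τ) (hg2 : r ≤ 2 * R2 → hg ≤ τ) :
    min 1 ((c0 * ε * 2 ^ (-ε) * Z1 ^ (-1 - ε)) / 4) * (1 + r) ^ (-1 - ε) ≤
      ε * F / √(1 + s ^ 2) * d + M * θ * (-hg) + M * g * θ' * (4 * s / R2 ^ 2) := by
  have hJ1 : 1 ≤ √(1 + s ^ 2) := Real.one_le_sqrt.2 (by nlinarith [sq_nonneg s])
  have hJs : |s| ≤ √(1 + s ^ 2) := Real.abs_le_sqrt (by linarith)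
  set J := √(1 + s ^ 2)
  have hJ0 : 0 < J := by linarith
  have hM0 : 0 < M := by rw [hM]; linarith
  have hF0 : 0 < F := lt_of_lt_of_le (by positivity) hF1
  have hP0 : 0 < (1 + r) ^ (-1 - ε) := by positivity
  have hP1 : (1 + r) ^ (-1 - ε) ≤ 1 :=
    Real.rpow_le_one_of_one_le_of_nonpos (by linarith) (by linarith)
  set P := (1 + r) ^ (-1 - ε) with hP
  set c1 := c0 * ε * 2 ^ (-ε) * Z1 ^ (-1 - ε) with hc1
  have hc1p : 0 < c1 := by positivity
  by_cases h : r ≤ R0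
  · have hrR : r ≤ R2 := h.trans hR02
    rw [hθR hrR, hθR' hrR]
    have a1 : F ≤ 2 * J := hF2.trans (by
      calc (2 * J) ^ ε ≤ (2 * J) ^ (1:ℝ) :=
            Real.rpow_le_rpow_of_exponent_le (by linarith) hε1.le
        _ = 2 * J := Real.rpow_one _)
    have a2 : ε * F / J ≤ 2 := by
      rw [div_le_iff₀ hJ0]; nlinarith
    have a3 : 0 ≤ ε * F / J := by positivity
    have a4 : -(2 * A) ≤ ε * F / J * d := by
      have := (abs_le.1 hd).1
      nlinarith
    have a5 := hg1 h
    have a6 : min 1 (c1 / 4) * P ≤ 1 * 1 := by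
      gcongr; exact min_le_left _ _
    have a7 : M * (1 / 2) ≤ M * (-hg) := by gcongr; linarith
    rw [hM] at a7 ⊢
    linarith
  · push Not at h
    have hd2 := hd1 h.le
    have b1 : c1 * P ≤ ε * F / J * d := by
      have e1 : 2 ^ (-ε) * (Z1 ^ (-1 - ε) * P) ≤ F / J := by
        rw [hP, ← Real.mul_rpow (by positivity) (by positivity)]
        calc 2 ^ (-ε) * (Z1 * (1 + r)) ^ (-1 - ε) ≤ 2 ^ (-ε) * J ^ (-1 - ε) := by
              gcongr 2 ^ (-ε) * ?_
              exact Real.rpow_le_rpow_of_nonpos hJ0 hJ (by linarith)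
          _ = (2 * J) ^ (-ε) / J := by
              rw [Real.mul_rpow (by positivity) hJ0.le, show -1 - ε = -ε - 1 by ring,
                Real.rpow_sub_one hJ0.ne']
              ring
          _ ≤ F / J := by gcongr
      calc c1 * P = ε * (2 ^ (-ε) * (Z1 ^ (-1 - ε) * P)) * c0 := by rw [hc1]; ring
        _ ≤ ε * (F / J) * d := by gcongr
        _ = _ := by ring
    have b0 : min 1 (c1 / 4) * P ≤ c1 / 4 * P := by gcongr; exact min_le_right _ _
    by_cases h2 : 2 * R2 ≤ r
    · rw [(hθ2 h2).1, (hθ2 h2).2]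
      nlinarith
    · push Not at h2
      have b2 : -(c1 / 4 * P) ≤ M * θ * (-hg) := by
        have := hg2 h2.le
        have e1 : M * τ ≤ c1 / 4 * P := hτ2.trans (by
          gcongr c1 / 4 * ?_
          exact Real.rpow_le_rpow_of_nonpos (by positivity) (by linarith) (by linarith))
        have e2 : M * θ * hg ≤ M * 1 * τ := by
          calc M * θ * hg ≤ M * θ * τ := by gcongr
            _ ≤ M * 1 * τ := by gcongr
        linarith
      have b3 : -(ε * F / J * d / 2) ≤ M * g * θ' * (4 * s / R2 ^ 2) := by
        have hfd : 0 ≤ ε * F / J * d / 2 := by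
          have : 0 ≤ d := by linarith
          positivity
        rcases le_or_gt 0 s with hs | hs
        · have : 0 ≤ M * g * θ' * (4 * s / R2 ^ 2) := by positivity
          linarith
        · have hF3' := hF3 hs.le
          have hgB' := hgB h2.le
          have hs' : -s ≤ J := by rw [abs_of_neg hs] at hJs; exact hJs
          have k1 : J ^ 2 ≤ (3 * Z1) ^ 2 * J ^ ε * R2 ^ (2 - ε) := by
            have hJ3 : J ≤ 3 * Z1 * R2 := by
              calc J ≤ Z1 * (1 + r) := hJ
                _ ≤ Z1 * (3 * R2) := by gcongr; linarith
                _ = _ := by ring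
            calc J ^ 2 = J ^ ε * J ^ (2 - ε) := by
                  rw [← Real.rpow_add hJ0]
                  norm_num
              _ ≤ J ^ ε * (3 * Z1 * R2) ^ (2 - ε) := by
                  gcongr; linarith
              _ = J ^ ε * ((3 * Z1) ^ (2 - ε) * R2 ^ (2 - ε)) := by
                  rw [Real.mul_rpow (by positivity) (by positivity)]
              _ ≤ J ^ ε * ((3 * Z1) ^ (2:ℝ) * R2 ^ (2 - ε)) := by
                  gcongr <;> linarith
              _ = _ := by rw [Real.rpow_two]; ring
          have k2 : R2 ^ ε * R2 ^ (2 - ε) = R2 ^ 2 := by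
            rw [← Real.rpow_add (by positivity)]
            norm_num
          have k3 : M * g * θ' * (4 * (-s)) * (2 * J) ≤ ε * F * d * R2 ^ 2 := by
            calc M * g * θ' * (4 * (-s)) * (2 * J) ≤ M * B * D * (4 * J) * (2 * J) := by
                  have : 0 ≤ -s := by linarith
                  gcongr
              _ = 8 * M * B * D * J ^ 2 := by ring
              _ ≤ 8 * M * B * D * ((3 * Z1) ^ 2 * J ^ ε * R2 ^ (2 - ε)) := by gcongr
              _ = (8 * M * B * D * (3 * Z1) ^ 2) * (J ^ ε * R2 ^ (2 - ε)) := by ring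
              _ ≤ (c0 * ε * R2 ^ ε) * (J ^ ε * R2 ^ (2 - ε)) := by gcongr
              _ = ε * J ^ ε * c0 * (R2 ^ ε * R2 ^ (2 - ε)) := by ring
              _ = ε * J ^ ε * c0 * R2 ^ 2 := by rw [k2]
              _ ≤ ε * F * d * R2 ^ 2 := by gcongr
          have k4 : M * g * θ' * (4 * (-s)) / R2 ^ 2 ≤ ε * F * d / (2 * J) := by
            rw [div_le_div_iff₀ (by positivity) (by positivity)]
            exact k3
          have e1 : ε * F * d / (2 * J) = ε * F / J * d / 2 := by field_simp
          have e2 : M * g * θ' * (4 * (-s)) / R2 ^ 2 = -(M * g * θ' * (4 * s / R2 ^ 2)) := by ring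
          linarith
      linarith


theorem ef_q {n : ℕ} (V : EuclideanSpace ℝ (Fin n) → ℝ) (hV : ContDiff ℝ (⊤ : ℕ∞) V)
    (φ : EFP n → ℝ → EFP n)
    (h0 : ∀ w, φ w 0 = w) (hφ : ∀ w t, HasDerivAt (φ w) (efX V (φ w t)) t)
    (ψ : ℝ → ℝ) (hψ : ContDiff ℝ (⊤ : ℕ∞) ψ) (g : EFP n → ℝ) (hg : ContDiff ℝ (⊤ : ℕ∞) g)
    (ε M R2 : ℝ) (h1 : 0 < ε) (h2 : ε < 1) :
    ContDiff ℝ (⊤ : ℕ∞) (fun w : EFP n => ψ (‖w.2‖ ^ 2 + V w.1) *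
      (Real.exp (-ε * Real.arsinh (inner ℝ w.1 w.2)) +
        M * Real.smoothTransition (2 - ‖w.1‖ ^ 2 / R2 ^ 2) * g w)) ∧
    ∀ w : EFP n, -(hamDeriv V (fun w : EFP n => ψ (‖w.2‖ ^ 2 + V w.1) *
      (Real.exp (-ε * Real.arsinh (inner ℝ w.1 w.2)) +
        M * Real.smoothTransition (2 - ‖w.1‖ ^ 2 / R2 ^ 2) * g w)) w) =
      ψ (‖w.2‖ ^ 2 + V w.1) * (ε * Real.exp (-ε * Real.arsinh (inner ℝ w.1 w.2)) /
          √(1 + (inner ℝ w.1 w.2 : ℝ) ^ 2) * efd V w +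
        M * Real.smoothTransition (2 - ‖w.1‖ ^ 2 / R2 ^ 2) * (-(fderiv ℝ g w (efX V w))) +
        M * g w * deriv Real.smoothTransition (2 - ‖w.1‖ ^ 2 / R2 ^ 2) *
          (4 * inner ℝ w.1 w.2 / R2 ^ 2)) := by
  have hs : ContDiff ℝ (⊤ : ℕ∞) (fun w : EFP n => (inner ℝ w.1 w.2 : ℝ)) :=
    contDiff_fst.inner ℝ contDiff_snd
  have hz : ContDiff ℝ (⊤ : ℕ∞) (fun w : EFP n => ‖w.1‖ ^ 2) := contDiff_fst.norm_sq ℝ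
  have hζ : ContDiff ℝ (⊤ : ℕ∞) (fun w : EFP n => ‖w.2‖ ^ 2) := contDiff_snd.norm_sq ℝ
  have hq : ContDiff ℝ (⊤ : ℕ∞) (fun w : EFP n => ψ (‖w.2‖ ^ 2 + V w.1) *
      (Real.exp (-ε * Real.arsinh (inner ℝ w.1 w.2)) +
        M * Real.smoothTransition (2 - ‖w.1‖ ^ 2 / R2 ^ 2) * g w)) := by
    refine (hψ.comp (hζ.add (hV.comp contDiff_fst))).mul (ContDiff.add ?_ ?_)
    · exact (contDiff_const.mul (Real.contDiff_arsinh.comp hs)).exp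
    · exact (contDiff_const.mul (Real.smoothTransition.contDiff.comp
        (contDiff_const.sub (hz.div_const _)))).mul hg
  refine ⟨hq, fun w => ?_⟩
  have hVd : Differentiable ℝ V := hV.differentiable (by simp)
  obtain ⟨c1, c2, c3⟩ := ef_curve V hVd (φ w) (hφ w)
  set q := (fun w : EFP n => ψ (‖w.2‖ ^ 2 + V w.1) *
      (Real.exp (-ε * Real.arsinh (inner ℝ w.1 w.2)) +
        M * Real.smoothTransition (2 - ‖w.1‖ ^ 2 / R2 ^ 2) * g w)) with hqdef
  have hd1 : HasDerivAt (fun t => q (φ w t)) (hamDeriv V q w) 0 := by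
    have a : HasFDerivAt q (fderiv ℝ q w) (φ w 0) := by
      rw [h0]; exact ((hq.differentiable (by simp)) w).hasFDerivAt
    have := a.comp_hasDerivAt (0:ℝ) (hφ w 0)
    rw [h0] at this
    exact this
  have hgd : HasDerivAt (fun t => g (φ w t)) (fderiv ℝ g w (efX V w)) 0 := by
    have a : HasFDerivAt g (fderiv ℝ g w) (φ w 0) := by
      rw [h0]; exact ((hg.differentiable (by simp)) w).hasFDerivAt
    have := a.comp_hasDerivAt (0:ℝ) (hφ w 0)
    rw [h0] at this
    exact this
  have hFd := HasDerivAt.comp (0:ℝ) (ef_F ε h1 h2 (inner ℝ (φ w 0).1 (φ w 0).2)).1 (c2 0)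
  have hstd : Differentiable ℝ Real.smoothTransition :=
    (Real.smoothTransition.contDiff (n := 1)).differentiable (by simp)
  have hθd := HasDerivAt.comp (0:ℝ)
    (hstd (2 - ‖(φ w 0).1‖ ^ 2 / R2 ^ 2)).hasDerivAt (((c1 0).div_const (R2 ^ 2)).const_sub 2)
  have hd2 := ((hFd.add ((hθd.const_mul M).mul hgd)).const_mul (ψ (efp V w)))
  have hd3 := hd1.unique (hd2.congr_of_eventuallyEq (by
    filter_upwards with t
    have : efp V (φ w t) = efp V w := by rw [c3, h0]
    simp only [hqdef]
    rw [show ‖(φ w t).2‖ ^ 2 + V (φ w t).1 = efp V w from this]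
    rfl))
  rw [hd3]
  simp only [h0, Function.comp, efp]
  ring


set_option maxHeartbeats 1600000 in
/-- The main escape-function proposition (Section 4 of the paper), in the Euclidean
model: under the non-trapping assumption for energies in `(λ² − δ₀, λ² + δ₀)`, for each
`ε ∈ (0, 1/4)` there are a cutoff `ψ ∈ C_c^∞(ℝ; [0,1])`, `ψ ≡ 1` near `λ²`, a smooth
`q ≥ 0` with `c′(1+|z|)^{−ε}ψ(p) ≤ q ≤ C(1+|z|)^{ε}`, `−H_p q ≥ 0` everywhere, and
`−H_p q ≥ c″(1+|z|)^{−1−ε}ψ(p)`. -/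
theorem escape_function_proposition (n : ℕ) (hn : 1 ≤ n)
    (V : EuclideanSpace ℝ (Fin n) → ℝ) (hV : IsLongRangePotential V)
    (lam δ₀ : ℝ) (hlam : 0 < lam) (hδ₀ : 0 < δ₀)
    (hnt : ∀ z ζ : ℝ → EuclideanSpace ℝ (Fin n),
      (∀ t : ℝ, HasDerivAt z ((2 : ℝ) • ζ t) t) →
      (∀ t : ℝ, HasDerivAt ζ (-(gradient V (z t))) t) →
      (‖ζ 0‖ ^ 2 + V (z 0)) ∈ Set.Ioo (lam ^ 2 - δ₀) (lam ^ 2 + δ₀) →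
      Tendsto (fun t => ‖z t‖) atTop atTop ∧
        Tendsto (fun t => ‖z t‖) atBot atTop) :
    ∀ ε : ℝ, ε ∈ Set.Ioo (0 : ℝ) (1 / 4) →
      ∃ (ψ : ℝ → ℝ) (q : EuclideanSpace ℝ (Fin n) × EuclideanSpace ℝ (Fin n) → ℝ)
        (C c' c'' : ℝ),
        ContDiff ℝ (⊤ : ℕ∞) ψ ∧ HasCompactSupport ψ ∧ (∀ σ : ℝ, ψ σ ∈ Set.Icc (0 : ℝ) 1) ∧
        (∀ᶠ σ in nhds (lam ^ 2), ψ σ = 1) ∧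
        ContDiff ℝ (⊤ : ℕ∞) q ∧ 0 < C ∧ 0 < c' ∧ 0 < c'' ∧
        ∀ w : EuclideanSpace ℝ (Fin n) × EuclideanSpace ℝ (Fin n),
          (0 ≤ q w ∧ q w ≤ C * (1 + ‖w.1‖) ^ ε) ∧
          c' * (1 + ‖w.1‖) ^ (-ε) * ψ (‖w.2‖ ^ 2 + V w.1) ≤ q w ∧
          0 ≤ -(hamDeriv V q w) ∧
          c'' * (1 + ‖w.1‖) ^ (-1 - ε) * ψ (‖w.2‖ ^ 2 + V w.1) ≤ -(hamDeriv V q w) := by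
  intro ε ⟨hε, hε4⟩
  have hε1 : ε < 1 := by linarith
  obtain ⟨C0, hC0, hVb, hgb, hdec, hgs, K0, hK0⟩ := ef_pot V hV
  obtain ⟨hXs, hXl⟩ := ef_field V hgs K0 hK0
  have hVs := hV.1
  have hVd : Differentiable ℝ V := hVs.differentiable (by simp)
  have hX : LipschitzWith (max 2 K0) (efX V) := hXl
  obtain ⟨φ, h0, hφ⟩ := ef_flow_exists (efX V) (max 2 K0) hX hXs
  have hlam2 : 0 < lam ^ 2 := by positivity
  obtain ⟨δ, hδ, hδ1, hδ2⟩ : ∃ δ : ℝ, 0 < δ ∧ 2 * δ < δ₀ ∧ 2 * δ ≤ lam ^ 2 / 2 := by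
    refine ⟨min (δ₀ / 4) (lam ^ 2 / 4), by positivity, ?_, ?_⟩
    · linarith [min_le_left (δ₀ / 4) (lam ^ 2 / 4)]
    · linarith [min_le_right (δ₀ / 4) (lam ^ 2 / 4)]
  let ψ : ContDiffBump (lam ^ 2) := ⟨δ / 2, δ, by positivity, by linarith⟩
  have hψ0 : ∀ σ, ψ σ ≠ 0 → |σ - lam ^ 2| ≤ δ := by
    intro σ h
    by_contra hc
    push Not at hc
    exact h (ψ.zero_of_le_dist (by rw [Real.dist_eq]; exact hc.le))
  obtain ⟨R0, hR01, hR0⟩ := hdec (lam ^ 2 / 6) (by positivity)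
  have hin : ∀ w : EFP n, |(inner ℝ w.1 (gradient V w.1) : ℝ)| ≤ ‖w.1‖ * ‖gradient V w.1‖ :=
    fun w => abs_real_inner_le_norm _ _
  have hefd : ∀ w : EFP n, R0 ≤ ‖w.1‖ → |efp V w - lam ^ 2| ≤ 2 * δ →
      lam ^ 2 / 2 ≤ efd V w := by
    intro w h1 h2
    obtain ⟨a1, a2⟩ := hR0 _ h1
    have a3 := (abs_le.1 ((hin w).trans a2)).2
    have a4 := (abs_le.1 a1).2
    have a5 := (abs_le.1 h2).1
    unfold efd
    unfold efp at a5
    linarith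
  obtain ⟨A, hA⟩ : ∃ A, A = 2 * (lam ^ 2 + 2 * δ + C0) + C0 := ⟨_, rfl⟩
  have hA0 : 0 ≤ A := by rw [hA]; positivity
  have hζ : ∀ w : EFP n, |efp V w - lam ^ 2| ≤ 2 * δ → ‖w.2‖ ^ 2 ≤ lam ^ 2 + 2 * δ + C0 := by
    intro w h2
    have a4 := (abs_le.1 (hVb w.1)).1
    have a5 := (abs_le.1 h2).2
    unfold efp at a5
    linarith
  have hefdA : ∀ w : EFP n, |efp V w - lam ^ 2| ≤ 2 * δ → |efd V w| ≤ A := by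
    intro w h2
    have a3 := abs_le.1 ((hin w).trans (hgb w.1))
    have a4 := hζ w h2
    have a5 := sq_nonneg ‖w.2‖
    unfold efd
    rw [abs_le, hA]
    constructor <;> nlinarith
  obtain ⟨Z1, hZ⟩ : ∃ Z1, Z1 = 1 + (lam ^ 2 + 2 * δ + C0) := ⟨_, rfl⟩
  have hZ1 : 1 ≤ Z1 := by rw [hZ]; have : 0 ≤ lam ^ 2 + 2 * δ + C0 := by positivity
                          linarith
  have hJZ : ∀ w : EFP n, |efp V w - lam ^ 2| ≤ 2 * δ →
      √(1 + (inner ℝ w.1 w.2 : ℝ) ^ 2) ≤ Z1 * (1 + ‖w.1‖) := by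
    intro w h2
    have a1 := hζ w h2
    have a2 : ‖w.2‖ ≤ Z1 := by rw [hZ]; nlinarith [sq_nonneg (‖w.2‖ - 1)]
    have a3 : |(inner ℝ w.1 w.2 : ℝ)| ≤ ‖w.1‖ * Z1 :=
      (abs_real_inner_le_norm _ _).trans (by gcongr)
    have a4 : (inner ℝ w.1 w.2 : ℝ) ^ 2 ≤ (‖w.1‖ * Z1) ^ 2 := sq_le_sq' (by
      linarith [(abs_le.1 a3).1]) (abs_le.1 a3).2
    apply Real.sqrt_le_iff.2 ⟨by positivity, ?_⟩
    have a5 : 1 ≤ Z1 ^ 2 := one_le_pow₀ hZ1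
    have a6 : 0 ≤ Z1 ^ 2 * ‖w.1‖ := by positivity
    nlinarith
  have hnt' : ∀ w, |efp V w - lam ^ 2| ≤ 2 * δ →
      Tendsto (fun t => ‖(φ w t).1‖) atTop atTop := by
    intro w hw
    refine (hnt (fun t => (φ w t).1) (fun t => (φ w t).2) (fun t => ?_) (fun t => ?_) ?_).1
    · exact (hasFDerivAt_fst (𝕜 := ℝ) (p := φ w t)).comp_hasDerivAt t (hφ w t)
    · exact (hasFDerivAt_snd (𝕜 := ℝ) (p := φ w t)).comp_hasDerivAt t (hφ w t)
    · simp only [h0]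
      have := abs_le.1 hw
      unfold efp at this
      constructor <;> linarith
  have hesc := ef_escape V hVd C0 hVb (max 2 K0) hX φ h0 hφ (lam ^ 2) (2 * δ) R0 (by linarith)
    (fun w h1 h2 => lt_of_lt_of_le (by positivity) (hefd w h1 h2)) hnt'
  obtain ⟨B, hB0, hB⟩ := hesc (R0 + 2) (by linarith)
  let χ : EFP n → ℝ := fun w => max 0 (min 1 (R0 + 2 - ‖w.1‖))
  have hχL : LipschitzWith 1 χ := by
    have : LipschitzWith 1 (fun w : EFP n => R0 + 2 - ‖w.1‖) := by
      refine LipschitzWith.of_dist_le_mul fun w v => ?_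
      rw [Real.dist_eq, NNReal.coe_one, one_mul]
      calc |R0 + 2 - ‖w.1‖ - (R0 + 2 - ‖v.1‖)| = |‖w.1‖ - ‖v.1‖| := by
            rw [abs_sub_comm]; congr 1; ring
        _ ≤ ‖w.1 - v.1‖ := abs_norm_sub_norm_le _ _
        _ ≤ dist w v := by rw [← dist_eq_norm]; exact le_max_left _ _
    exact (this.const_min 1).const_max 0
  have hχ0 : ∀ w, 0 ≤ χ w := fun w => le_max_left _ _
  have hχ1 : ∀ w, χ w ≤ 1 := fun w => max_le zero_le_one (min_le_left _ _)
  have hχR : ∀ w : EFP n, R0 + 2 < ‖w.1‖ → χ w = 0 := by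
    intro w hw
    exact max_eq_left ((min_le_right _ _).trans (by linarith))
  have hχR1 : ∀ w : EFP n, ‖w.1‖ ≤ R0 + 1 → χ w = 1 := by
    intro w hw
    simp only [χ]
    rw [min_eq_left (by linarith)]; simp
  obtain ⟨st0, st1, st2, D, hD, hDb⟩ := ef_st
  obtain ⟨M, hM⟩ : ∃ M, M = 2 * (2 * A + 1) := ⟨_, rfl⟩
  have hM0 : 0 < M := by rw [hM]; positivity
  obtain ⟨R2, hR2a, hR2b⟩ : ∃ R2, R0 + 2 ≤ R2 ∧
      8 * M * B * D * (3 * Z1) ^ 2 ≤ (lam ^ 2 / 2) * ε * R2 ^ ε := by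
    have h1 := (tendsto_rpow_atTop hε).eventually_ge_atTop
      (8 * M * B * D * (3 * Z1) ^ 2 / ((lam ^ 2 / 2) * ε))
    obtain ⟨R2, a, b⟩ := (h1.and (eventually_ge_atTop (R0 + 2))).exists
    refine ⟨R2, b, ?_⟩
    rw [div_le_iff₀ (by positivity)] at a
    linarith
  have hR21 : 1 ≤ R2 := by linarith
  obtain ⟨T, hT0, hT⟩ := hesc (2 * R2 + 1) (by linarith)
  obtain ⟨Λ, hΛ⟩ := ef_b_lip (efX V) (max 2 K0) hX φ h0 hφ χ 1 hχL T hT0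
  have hbd := ef_b_deriv (efX V) (max 2 K0) hX φ h0 hφ χ 1 hχL T hT0
  have hbB := ef_bbound V hVd (max 2 K0) hX φ h0 hφ (lam ^ 2) (2 * δ) (R0 + 2) B hB0 hB χ
    hχL.continuous hχ1 hχR T hT0
  have hb0 : ∀ w, 0 ≤ ∫ t in (0:ℝ)..T, χ (φ w t) := fun w =>
    intervalIntegral.integral_nonneg hT0 fun t _ => hχ0 _
  obtain ⟨c1, hc1⟩ : ∃ c1, c1 = (lam ^ 2 / 2) * ε * 2 ^ (-ε) * Z1 ^ (-1 - ε) := ⟨_, rfl⟩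
  have hc1p : 0 < c1 := by rw [hc1]; positivity
  obtain ⟨τ, hτ, hτ1, hτ2⟩ : ∃ τ : ℝ, 0 < τ ∧ τ ≤ 1 / 2 ∧
      M * τ ≤ c1 / 4 * (1 + 2 * R2) ^ (-1 - ε) := by
    refine ⟨min (1 / 2) (c1 / 4 * (1 + 2 * R2) ^ (-1 - ε) / M), by positivity,
      min_le_left _ _, ?_⟩
    rw [mul_comm, ← le_div_iff₀ hM0]
    exact min_le_right _ _
  have hpc : Continuous (efp V) := by
    have := hVd.continuous
    unfold efp; fun_prop
  obtain ⟨η, hη, hη1, hηK⟩ : ∃ η : ℝ, 0 < η ∧ η ≤ 1 ∧ ∀ w : EFP n, ‖w.1‖ ≤ 2 * R2 →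
      |efp V w - lam ^ 2| ≤ δ → ∀ v ∈ Metric.ball w η,
        ‖v.1‖ ≤ 2 * R2 + 1 ∧ |efp V v - lam ^ 2| ≤ 2 * δ := by
    have hc := ef_shell_compact V hVd.continuous C0 hVb (lam ^ 2) δ (2 * R2)
    have o1 : IsOpen {w : EFP n | ‖w.1‖ < 2 * R2 + 1} := isOpen_lt (by fun_prop) continuous_const
    have o2 : IsOpen {w : EFP n | |efp V w - lam ^ 2| < 2 * δ} :=
      isOpen_lt (by fun_prop) continuous_const
    obtain ⟨η0, hη0, hsub⟩ := hc.exists_thickening_subset_open (o1.inter o2) (by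
      rintro w ⟨a, b⟩
      exact ⟨by change ‖w.1‖ < 2 * R2 + 1; linarith,
        by change |efp V w - lam ^ 2| < 2 * δ; linarith⟩)
    refine ⟨min η0 1, by positivity, min_le_right _ _, fun w a b v hv => ?_⟩
    have hv' := hsub (Metric.ball_subset_thickening (show w ∈ {w : EFP n | ‖w.1‖ ≤ 2 * R2 ∧
      |efp V w - lam ^ 2| ≤ δ} from ⟨a, b⟩) η0
      (Metric.ball_subset_ball (min_le_left _ _) hv))
    exact ⟨hv'.1.le, hv'.2.le⟩
  obtain ⟨g, hgs, hg0, hgB, hgD⟩ := ef_moll (efX V) (max 2 K0) hX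
    (fun w => ∫ t in (0:ℝ)..T, χ (φ w t)) Λ hΛ hb0 (fun w => χ (φ w T) - χ w) hbd τ η hτ hη
  have hgB' : ∀ w : EFP n, |efp V w - lam ^ 2| ≤ δ → ‖w.1‖ ≤ 2 * R2 → g w ≤ B :=
    fun w a b => hgB w B fun v hv => hbB v (hηK w b a v hv).2
  have hDz : ∀ w : EFP n, |efp V w - lam ^ 2| ≤ δ → ‖w.1‖ ≤ 2 * R2 → ∀ v ∈ Metric.ball w η,
      χ (φ v T) = 0 := by
    intro w a b v hv
    obtain ⟨k1, k2⟩ := hηK w b a v hv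
    apply hχR
    have := hT v k1 k2 T le_rfl
    linarith
  have hg2 : ∀ w : EFP n, |efp V w - lam ^ 2| ≤ δ → ‖w.1‖ ≤ 2 * R2 →
      fderiv ℝ g w (efX V w) ≤ τ := by
    intro w a b
    have := hgD w 0 fun v hv => by
      have := hχ0 v
      rw [hDz w a b v hv]; linarith
    linarith
  have hg1 : ∀ w : EFP n, |efp V w - lam ^ 2| ≤ δ → ‖w.1‖ ≤ R0 →
      fderiv ℝ g w (efX V w) ≤ -1 + τ := by
    intro w a b
    refine hgD w (-1) fun v hv => ?_
    have : χ v = 1 := by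
      apply hχR1
      have h1 : ‖v.1 - w.1‖ ≤ dist v w := by rw [← dist_eq_norm]; exact le_max_left _ _
      have h2 : dist v w < η := hv
      have h3 := norm_le_insert' v.1 w.1
      linarith
    rw [hDz w a (by linarith) v hv, this]; norm_num
  obtain ⟨hqs, hqd⟩ := ef_q V hVs φ h0 hφ ψ ψ.contDiff g hgs ε M R2 hε hε1
  -- properties of the spatial cutoff
  have hR2p : 0 < R2 := by linarith
  have hθR : ∀ r : ℝ, 0 ≤ r → r ≤ R2 → 1 ≤ 2 - r ^ 2 / R2 ^ 2 := by
    intro r hr h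
    have : r ^ 2 / R2 ^ 2 ≤ 1 := by
      rw [div_le_one (by positivity)]; gcongr
    linarith
  have hθ2 : ∀ r : ℝ, 2 * R2 ≤ r → 2 - r ^ 2 / R2 ^ 2 ≤ 0 := by
    intro r h
    have : 2 ≤ r ^ 2 / R2 ^ 2 := by
      rw [le_div_iff₀ (by positivity)]; nlinarith
    linarith
  refine ⟨ψ, _, (2 * Z1) ^ ε + M * B, (2 * Z1) ^ (-ε), min 1 (c1 / 4), ψ.contDiff,
    ψ.hasCompactSupport, fun σ => ⟨ψ.nonneg, ψ.le_one⟩, ψ.eventuallyEq_one, hqs, by positivity,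
    by positivity, by positivity, fun w => ?_⟩
  rw [hqd w]
  have hψn : 0 ≤ ψ (‖w.2‖ ^ 2 + V w.1) := ψ.nonneg
  have hψ1 : ψ (‖w.2‖ ^ 2 + V w.1) ≤ 1 := ψ.le_one
  have hr := norm_nonneg w.1
  by_cases hz : ψ (‖w.2‖ ^ 2 + V w.1) = 0
  · rw [hz]
    simp only [zero_mul, mul_zero, le_refl, and_true, true_and]
    positivity
  have hsh : |efp V w - lam ^ 2| ≤ δ := hψ0 _ hz
  have hsh2 : |efp V w - lam ^ 2| ≤ 2 * δ := hsh.trans (by linarith)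
  obtain ⟨-, hF1, hF2, hF3⟩ := ef_F ε hε hε1 (inner ℝ w.1 w.2)
  have hJ := hJZ w hsh2
  have main := ef_ineq ε (lam ^ 2 / 2) A B D Z1 R0 R2 M τ hε hε1 (by positivity) hA0 hB0 hD hZ1
    hR21 (by linarith) hM hR2b hτ hτ1 (hc1 ▸ hτ2) ‖w.1‖ (inner ℝ w.1 w.2) (efd V w) (g w)
    (fderiv ℝ g w (efX V w)) (Real.smoothTransition (2 - ‖w.1‖ ^ 2 / R2 ^ 2))
    (deriv Real.smoothTransition (2 - ‖w.1‖ ^ 2 / R2 ^ 2)) _ hr hJ hF1 hF2 hF3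
    (hefdA w hsh2) (fun h => hefd w h hsh2) (Real.smoothTransition.nonneg _)
    (Real.smoothTransition.le_one _)
    (fun h => Real.smoothTransition.one_of_one_le (hθR _ hr h)) (fun h => st1 _ (hθR _ hr h))
    (st0 _) (hDb _)
    (fun h => ⟨Real.smoothTransition.zero_of_nonpos (hθ2 _ h), st2 _ (hθ2 _ h)⟩)
    (hg0 w) (hgB' w hsh) (hg1 w hsh) (hg2 w hsh)
  rw [← hc1] at main
  have hJ1 : 0 < √(1 + (inner ℝ w.1 w.2 : ℝ) ^ 2) := by positivity
  have hθ0 := Real.smoothTransition.nonneg (2 - ‖w.1‖ ^ 2 / R2 ^ 2)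
  have hθ1 := Real.smoothTransition.le_one (2 - ‖w.1‖ ^ 2 / R2 ^ 2)
  have hgw := hg0 w
  have hθg : Real.smoothTransition (2 - ‖w.1‖ ^ 2 / R2 ^ 2) * g w ≤ B := by
    rcases le_total ‖w.1‖ (2 * R2) with h | h
    · calc _ ≤ 1 * B := by
            gcongr; exact hgB' w hsh h
        _ = B := one_mul _
    · rw [Real.smoothTransition.zero_of_nonpos (hθ2 _ h), zero_mul]; exact hB0
  have hm0 : 0 ≤ min 1 (c1 / 4) * (1 + ‖w.1‖) ^ (-1 - ε) := by positivity
  refine ⟨⟨by positivity, ?_⟩, ?_, mul_nonneg hψn (hm0.trans main), ?_⟩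
  · have e1 : 1 ≤ (1 + ‖w.1‖) ^ ε := Real.one_le_rpow (by linarith) hε.le
    have e2 : Real.exp (-ε * Real.arsinh (inner ℝ w.1 w.2)) ≤ (2 * Z1) ^ ε * (1 + ‖w.1‖) ^ ε := by
      rw [← Real.mul_rpow (by positivity) (by positivity)]
      refine hF2.trans (Real.rpow_le_rpow (by positivity) (by linarith) hε.le)
    have e3 : M * (Real.smoothTransition (2 - ‖w.1‖ ^ 2 / R2 ^ 2) * g w) ≤
        M * B * (1 + ‖w.1‖) ^ ε := by
      calc _ ≤ M * B := by gcongr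
        _ = M * B * 1 := by ring
        _ ≤ _ := by gcongr
    calc _ ≤ 1 * (Real.exp (-ε * Real.arsinh (inner ℝ w.1 w.2)) +
        M * Real.smoothTransition (2 - ‖w.1‖ ^ 2 / R2 ^ 2) * g w) := by gcongr
      _ ≤ _ := by linarith
  · have e2 : (2 * Z1) ^ (-ε) * (1 + ‖w.1‖) ^ (-ε) ≤
        Real.exp (-ε * Real.arsinh (inner ℝ w.1 w.2)) := by
      rw [← Real.mul_rpow (by positivity) (by positivity)]
      refine le_trans (Real.rpow_le_rpow_of_nonpos (by positivity) ?_ (by linarith)) hF1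
      linarith
    rw [mul_comm]
    gcongr
    have : 0 ≤ M * Real.smoothTransition (2 - ‖w.1‖ ^ 2 / R2 ^ 2) * g w := by positivity
    linarith
  · rw [mul_comm]
    gcongr
end
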